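/- Let f and g be real analytic functions on a connected open neighborhood of the origin in ℝ², neither of which is constant on any neighborhood of the origin, and suppose J[f,g] ≡ 0. Then there exist an open neighborhood V of the origin, a non-constant real analytic function σ : V → ℝ with σ(0,0) = 0, and non-constant real analytic functions α, β of one real variable such that f = α∘σ and g = β∘σ on V. -/

import Mathlib

open Set Metric Topology Asymptotics MvPolynomial Matrix

/-- Partial derivative with respect to the first variable. -/
noncomputable def pdx (f : ℝ × ℝ → ℝ) (p : ℝ × ℝ) : ℝ :=
  deriv (fun x => f (x, p.2)) p.1

/-- Partial derivative with respect to the second variable. -/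
noncomputable def pdy (f : ℝ × ℝ → ℝ) (p : ℝ × ℝ) : ℝ :=
  deriv (fun y => f (p.1, y)) p.2

/-- The Laplacian `Δu = u_xx + u_yy`. -/
noncomputable def lap (f : ℝ × ℝ → ℝ) (p : ℝ × ℝ) : ℝ :=
  pdx (pdx f) p + pdy (pdy f) p

/-- The Hessian determinant `det D²u = u_xx u_yy - u_xy²`. -/
noncomputable def hessDet (f : ℝ × ℝ → ℝ) (p : ℝ × ℝ) : ℝ :=
  pdx (pdx f) p * pdy (pdy f) p - (pdx (pdy f) p) ^ 2

/-- The Jacobian `J[f,g] = f_x g_y - f_y g_x`. -/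
noncomputable def jacDet (f g : ℝ × ℝ → ℝ) (p : ℝ × ℝ) : ℝ :=
  pdx f p * pdy g p - pdy f p * pdx g p

/-- The coefficient of `x ^ i * y ^ k` in a power series in `y` over power series in `x`. -/
noncomputable def PowerSeries.coeff₂ (F : PowerSeries (PowerSeries ℝ)) (k i : ℕ) : ℝ :=
  PowerSeries.coeff i (PowerSeries.coeff k F)

/-- The monomial of index `n` of a double power series, evaluated at a point of the plane. -/
noncomputable def taylorTerm (F : PowerSeries (PowerSeries ℝ)) (p : ℝ × ℝ) (n : ℕ × ℕ) : ℝ :=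
  F.coeff₂ n.1 n.2 * (p.2 ^ n.1 * p.1 ^ n.2)

/-- The double power series `F` sums to `f` on a neighborhood of the origin. -/
def IsTaylor (f : ℝ × ℝ → ℝ) (F : PowerSeries (PowerSeries ℝ)) : Prop :=
  ∀ᶠ p in 𝓝 (0 : ℝ × ℝ), HasSum (taylorTerm F p) (f p)

namespace IsTaylor

variable {f g : ℝ × ℝ → ℝ} {F G : PowerSeries (PowerSeries ℝ)}

theorem congr (hf : IsTaylor f F) (h : f =ᶠ[𝓝 0] g) : IsTaylor g F := by
  filter_upwards [hf, h] with p hp h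
  rwa [← h]

theorem eventuallyEq (hf : IsTaylor f F) (hg : IsTaylor g F) : f =ᶠ[𝓝 0] g := by
  filter_upwards [hf, hg] with p h1 h2 using h1.unique h2

theorem add (hf : IsTaylor f F) (hg : IsTaylor g G) :
    IsTaylor (fun p => f p + g p) (F + G) := by
  filter_upwards [hf, hg] with p h1 h2
  refine (h1.add h2).congr_fun ?_
  intro n
  simp [taylorTerm, PowerSeries.coeff₂, add_mul]

theorem neg (hf : IsTaylor f F) : IsTaylor (fun p => - f p) (-F) := by
  filter_upwards [hf] with p h1
  refine h1.neg.congr_fun ?_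
  intro n
  simp [taylorTerm, PowerSeries.coeff₂]

theorem sub (hf : IsTaylor f F) (hg : IsTaylor g G) :
    IsTaylor (fun p => f p - g p) (F - G) := by
  simpa [sub_eq_add_neg] using hf.add hg.neg

theorem zero : IsTaylor (fun _ => 0) 0 := by
  refine Filter.Eventually.of_forall fun p => ?_
  convert hasSum_zero using 1
  ext n
  simp [taylorTerm, PowerSeries.coeff₂]

theorem monomial (k i : ℕ) : IsTaylor (fun p => p.2 ^ k * p.1 ^ i)
    (PowerSeries.X ^ k * PowerSeries.C (PowerSeries.X ^ i)) := by
  refine Filter.Eventually.of_forall fun p => ?_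
  convert hasSum_ite_eq (k, i) (p.2 ^ k * p.1 ^ i) using 1
  ext ⟨a, b⟩
  simp only [taylorTerm, PowerSeries.coeff₂, PowerSeries.coeff_mul_C, PowerSeries.coeff_X_pow,
    Prod.mk.injEq]
  by_cases h1 : a = k <;> by_cases h2 : b = i <;> simp [h1, h2, PowerSeries.coeff_X_pow]

theorem one : IsTaylor (fun _ => 1) 1 := by
  simpa using monomial 0 0

theorem mul (hf : IsTaylor f F) (hg : IsTaylor g G) :
    IsTaylor (fun p => f p * g p) (F * G) := by
  filter_upwards [hf, hg] with p h1 h2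
  have h3 := h1.mul h2 (summable_mul_of_summable_norm h1.summable.norm h2.summable.norm)
  let e : (Σ n : ℕ × ℕ, Finset.HasAntidiagonal.antidiagonal n.1 ×
      Finset.HasAntidiagonal.antidiagonal n.2) ≃
      (ℕ × ℕ) × (ℕ × ℕ) :=
    { toFun := fun s => ((s.2.1.1.1, s.2.2.1.1), (s.2.1.1.2, s.2.2.1.2))
      invFun := fun s => ⟨(s.1.1 + s.2.1, s.1.2 + s.2.2),
        ⟨(s.1.1, s.2.1), by simp⟩, ⟨(s.1.2, s.2.2), by simp⟩⟩
      left_inv := by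
        rintro ⟨⟨n, m⟩, ⟨⟨a, b⟩, h⟩, ⟨⟨c, d⟩, h'⟩⟩
        obtain rfl : a + b = n := Finset.HasAntidiagonal.mem_antidiagonal.1 h
        obtain rfl : c + d = m := Finset.HasAntidiagonal.mem_antidiagonal.1 h'
        rfl
      right_inv := fun s => rfl }
  rw [← e.hasSum_iff] at h3
  refine (h3.sigma (fun n => hasSum_fintype _)).congr_fun ?_
  rintro ⟨k, i⟩
  simp only [taylorTerm, PowerSeries.coeff₂, PowerSeries.coeff_mul, map_sum, Function.comp_apply]
  rw [Fintype.sum_prod_type, Finset.sum_mul,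
    ← Finset.sum_coe_sort (Finset.HasAntidiagonal.antidiagonal k)]
  refine Finset.sum_congr rfl fun a _ => ?_
  rw [Finset.sum_mul, ← Finset.sum_coe_sort (Finset.HasAntidiagonal.antidiagonal i)]
  refine Finset.sum_congr rfl fun b _ => ?_
  have ha := Finset.HasAntidiagonal.mem_antidiagonal.1 a.2
  have hb := Finset.HasAntidiagonal.mem_antidiagonal.1 b.2
  simp only [e, Equiv.coe_fn_mk]
  have hk : p.2 ^ k = p.2 ^ a.1.1 * p.2 ^ a.1.2 := by rw [← pow_add, ha]
  have hi : p.1 ^ i = p.1 ^ b.1.1 * p.1 ^ b.1.2 := by rw [← pow_add, hb]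
  rw [hk, hi]
  ring

theorem pow (hf : IsTaylor f F) (n : ℕ) : IsTaylor (fun p => f p ^ n) (F ^ n) := by
  induction n with
  | zero => simpa using one
  | succ n ih => simpa [pow_succ] using ih.mul hf

theorem sum {ι : Type*} (s : Finset ι) {f : ι → ℝ × ℝ → ℝ} {F : ι → PowerSeries (PowerSeries ℝ)}
    (h : ∀ i ∈ s, IsTaylor (f i) (F i)) : IsTaylor (fun p => ∑ i ∈ s, f i p) (∑ i ∈ s, F i) := by
  classical
  induction s using Finset.induction_on with
  | empty => simpa using zero
  | insert a s ha ih =>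
    simp only [Finset.sum_insert ha]
    exact (h a (by simp)).add (ih fun i hi => h i (by simp [hi]))

theorem axis (hf : IsTaylor f F) : ∀ᶠ x in 𝓝 (0 : ℝ),
    HasSum (fun i => PowerSeries.coeff i (PowerSeries.coeff 0 F) * x ^ i) (f (x, 0)) := by
  have hc : Filter.Tendsto (fun x : ℝ => (x, (0 : ℝ))) (𝓝 0) (𝓝 0) := by
    have : Continuous (fun x : ℝ => (x, (0 : ℝ))) := by fun_prop
    exact this.tendsto 0
  filter_upwards [hc.eventually hf] with x hx
  have hinj : Function.Injective (fun i : ℕ => ((0 : ℕ), i)) := fun a b h => by simpa using h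
  rw [← hinj.hasSum_iff] at hx
  · refine hx.congr_fun ?_
    intro i
    simp [taylorTerm, PowerSeries.coeff₂]
  · rintro ⟨k, i⟩ hk
    have : k ≠ 0 := by
      rintro rfl
      exact hk ⟨i, rfl⟩
    simp [taylorTerm, this]

/-- A real power series summing to zero near the origin has zero coefficients. -/
theorem _root_.coeff_eq_zero_of_eventually_hasSum_zero {c : ℕ → ℝ}
    (h : ∀ᶠ x in 𝓝 (0 : ℝ), HasSum (fun n => c n * x ^ n) 0) (n : ℕ) : c n = 0 := by
  have h1 : HasFPowerSeriesAt (0 : ℝ → ℝ) (FormalMultilinearSeries.ofScalars ℝ c) 0 := by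
    rw [hasFPowerSeriesAt_iff]
    filter_upwards [h] with x hx
    simpa [FormalMultilinearSeries.coeff_ofScalars, mul_comm] using hx
  have h2 := h1.eq_zero
  have h3 := congrFun ((FormalMultilinearSeries.ofScalars_series_eq_zero ℝ).1 h2) n
  simpa using h3

theorem eq_zero (hf : IsTaylor (fun _ => 0) F) : F = 0 := by
  obtain ⟨ε, hε, h⟩ := Metric.eventually_nhds_iff.1 hf
  have key : ∀ x : ℝ, |x| < ε → ∀ k, HasSum (fun i => F.coeff₂ k i * x ^ i) 0 := by
    intro x hx
    have hball : ∀ y : ℝ, |y| < ε → HasSum (taylorTerm F (x, y)) 0 := fun y hy => by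
      apply h
      rw [dist_zero_right, Prod.norm_def]
      exact max_lt hx hy
    have hsum : ∀ k, Summable (fun i => F.coeff₂ k i * x ^ i) := by
      intro k
      have hy : |ε / 2| < ε := by rw [abs_of_pos (by positivity)]; linarith
      have := (hball (ε / 2) hy).summable.prod_factor k
      have h2 := this.mul_left (((ε / 2) ^ k)⁻¹)
      refine h2.congr fun i => ?_
      simp only [taylorTerm]
      field_simp
    have h0 : ∀ᶠ y in 𝓝 (0 : ℝ),
        HasSum (fun k => (∑' i, F.coeff₂ k i * x ^ i) * y ^ k) 0 := by
      rw [Metric.eventually_nhds_iff]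
      refine ⟨ε, hε, fun y hy => ?_⟩
      have hy' : |y| < ε := by simpa using hy
      refine (hball y hy').prod_fiberwise fun k => ?_
      refine ((hsum k).hasSum.mul_right (y ^ k)).congr_fun fun i => ?_
      simp only [taylorTerm]
      ring
    intro k
    have := coeff_eq_zero_of_eventually_hasSum_zero h0 k
    rw [← this]
    exact (hsum k).hasSum
  ext k i
  refine coeff_eq_zero_of_eventually_hasSum_zero (c := fun i => F.coeff₂ k i) ?_ i
  rw [Metric.eventually_nhds_iff]
  exact ⟨ε, hε, fun x hx => key x (by simpa using hx) k⟩

theorem unique (hf : IsTaylor f F) (hg : IsTaylor g G) (h : f =ᶠ[𝓝 0] g) : F = G := by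
  refine sub_eq_zero.1 (eq_zero ((hf.sub hg).congr ?_))
  filter_upwards [h] with p hp
  simp [hp]

theorem coeff_zero_eq_zero_iff (hf : IsTaylor f F) :
    PowerSeries.coeff 0 F = 0 ↔ ∀ᶠ x in 𝓝 (0 : ℝ), f (x, 0) = 0 := by
  constructor
  · intro h
    filter_upwards [hf.axis] with x hx
    rw [h] at hx
    simp only [map_zero, zero_mul] at hx
    exact hx.unique hasSum_zero
  · intro h
    ext i
    refine coeff_eq_zero_of_eventually_hasSum_zero
      (c := fun i => PowerSeries.coeff i (PowerSeries.coeff 0 F)) ?_ i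
    filter_upwards [hf.axis, h] with x hx h
    rwa [← h]

theorem exists_bound (hf : IsTaylor f F) :
    ∃ r > 0, ∃ C, ∀ k i, |F.coeff₂ k i| * r ^ (k + i) ≤ C := by
  obtain ⟨ε, hε, h⟩ := Metric.eventually_nhds_iff.1 hf
  have hy : |ε / 2| < ε := by rw [abs_of_pos (by positivity)]; linarith
  have hs : Summable (taylorTerm F (ε / 2, ε / 2)) := by
    refine (h ?_).summable
    rw [dist_zero_right, Prod.norm_def]
    exact max_lt hy hy
  refine ⟨ε / 2, by positivity, ∑' n, |taylorTerm F (ε / 2, ε / 2) n|, fun k i => ?_⟩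
  refine le_trans (le_of_eq ?_) (hs.abs.le_tsum (k, i) fun _ _ => abs_nonneg _)
  simp only [taylorTerm]
  rw [abs_mul, ← pow_add, abs_of_nonneg (by positivity : 0 ≤ (ε / 2) ^ (k + i))]

end IsTaylor

/-- A function of two variables analytic at the origin is the sum of a double power series. -/
theorem AnalyticAt.exists_isTaylor {f : ℝ × ℝ → ℝ} (hf : AnalyticAt ℝ f 0) :
    ∃ F, IsTaylor f F := by
  obtain ⟨p, R, hp⟩ := hf
  obtain ⟨r, hr0, hr⟩ : ∃ r : NNReal, 0 < r ∧ (r : ENNReal) + r < R := by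
    obtain ⟨s, hs0, hs⟩ := ENNReal.lt_iff_exists_nnreal_btwn.1 hp.r_pos
    refine ⟨s / 2, by simpa using hs0, ?_⟩
    rw [← ENNReal.coe_add, add_halves]
    exact hs
  have hr1 : (r : ENNReal) < R := lt_of_le_of_lt le_self_add hr
  let a : ℕ → ℕ → ℝ := fun k l =>
    (p.changeOriginSeries k l (fun _ => ((1 : ℝ), (0 : ℝ)))) (fun _ => ((0 : ℝ), (1 : ℝ)))
  have hsum : Summable fun n : ℕ × ℕ => ‖p.changeOriginSeries n.1 n.2‖₊ * r ^ n.2 * r ^ n.1 := by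
    have h1 := p.changeOriginSeries_summable_aux₁ (hr.trans_le hp.r_le)
    rw [← (Equiv.sigmaAssoc _).summable_iff] at h1
    have h2 := NNReal.summable_sigma.1 h1
    rw [← (Equiv.sigmaEquivProd ℕ ℕ).summable_iff]
    refine NNReal.summable_of_le (fun n => ?_) h2.2
    have h3 := p.nnnorm_changeOriginSeries_le_tsum n.1 n.2
    simp only [Function.comp_apply, Equiv.sigmaEquivProd_apply]
    refine (mul_le_mul_left (mul_le_mul_left h3 _) _).trans (le_of_eq ?_)
    rw [← NNReal.tsum_mul_right, ← NNReal.tsum_mul_right]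
    rfl
  refine ⟨PowerSeries.mk fun k => PowerSeries.mk fun l => a k l, ?_⟩
  rw [IsTaylor, Metric.eventually_nhds_iff]
  refine ⟨r, hr0, ?_⟩
  rintro ⟨x, y⟩ hxy
  rw [dist_zero_right, Prod.norm_def, max_lt_iff] at hxy
  obtain ⟨hx, hy⟩ : ‖x‖ < r ∧ ‖y‖ < r := hxy
  have hx' : ‖((x : ℝ), (0 : ℝ))‖₊ < r := by
    rw [← NNReal.coe_lt_coe]; simpa [Prod.norm_def] using hx
  have hy' : ‖((0 : ℝ), (y : ℝ))‖₊ < r := by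
    rw [← NNReal.coe_lt_coe]; simpa [Prod.norm_def] using hy
  have hterm : ∀ n : ℕ × ℕ, taylorTerm (PowerSeries.mk fun k => PowerSeries.mk fun l => a k l) (x, y) n =
      (p.changeOriginSeries n.1 n.2 (fun _ => (x, 0))) (fun _ => (0, y)) := by
    rintro ⟨k, l⟩
    have e1 : (fun _ : Fin l => (x, (0 : ℝ))) = fun _ => x • ((1 : ℝ), (0 : ℝ)) := by simp
    have e2 : (fun _ : Fin k => ((0 : ℝ), y)) = fun _ => y • ((0 : ℝ), (1 : ℝ)) := by simp
    simp only [taylorTerm, PowerSeries.coeff₂, PowerSeries.coeff_mk]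
    rw [e1, e2, ContinuousMultilinearMap.map_smul_univ, ContinuousMultilinearMap.map_smul_univ]
    simp only [Finset.prod_const, Finset.card_univ, Fintype.card_fin,
      _root_.smul_apply, smul_eq_mul, a]
    ring
  have hS : Summable
      (taylorTerm (PowerSeries.mk fun k => PowerSeries.mk fun l => a k l) (x, y)) := by
    refine Summable.of_norm_bounded (NNReal.summable_coe.2 hsum) fun n => ?_
    rw [hterm]
    refine (ContinuousMultilinearMap.le_opNorm _ _).trans ?_
    simp only [Finset.prod_const, Finset.card_univ, Fintype.card_fin]
    push_cast
    gcongr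
    · refine (ContinuousMultilinearMap.le_opNorm _ _).trans ?_
      simp only [Finset.prod_const, Finset.card_univ, Fintype.card_fin]
      gcongr
      exact_mod_cast hx'.le
    · exact_mod_cast hy'.le
  have hfib : ∀ k, HasSum (fun l => taylorTerm
      (PowerSeries.mk fun k => PowerSeries.mk fun l => a k l) (x, y) (k, l))
      (p.changeOrigin (x, 0) k fun _ => (0, y)) := by
    intro k
    have hmem : ((x : ℝ), (0 : ℝ)) ∈ Metric.eball (0 : ℝ × ℝ) p.radius := by
      rw [Metric.mem_eball, edist_zero_right]
      exact (ENNReal.coe_lt_coe.2 hx').trans (hr1.trans_le hp.r_le)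
    have h1 := (p.hasFPowerSeriesOnBall_changeOrigin k (hp.r_pos.trans_le hp.r_le)).hasSum hmem
    rw [zero_add] at h1
    have h2 := h1.mapL (ContinuousMultilinearMap.apply ℝ (fun _ : Fin k => ℝ × ℝ) ℝ
      (fun _ => ((0 : ℝ), y)))
    refine h2.congr_fun fun l => ?_
    rw [hterm]
    rfl
  have h1 := hp.changeOrigin ((ENNReal.coe_lt_coe.2 hx').trans hr1)
  have h2 : HasSum (fun k => p.changeOrigin (x, 0) k fun _ => (0, y)) (f (x, y)) := by
    have hmem : ((0 : ℝ), (y : ℝ)) ∈ Metric.eball (0 : ℝ × ℝ) (R - ‖((x : ℝ), (0 : ℝ))‖₊) := by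
      rw [Metric.mem_eball, edist_zero_right, lt_tsub_iff_left]
      exact (ENNReal.add_lt_add (ENNReal.coe_lt_coe.2 hx') (ENNReal.coe_lt_coe.2 hy')).trans hr
    have h3 := h1.hasSum hmem
    simpa using h3
  have h3 := hS.hasSum.prod_fiberwise hfib
  rw [h2.unique h3]
  exact hS.hasSum

/-- A double power series with geometrically bounded coefficients sums to an analytic function. -/
theorem exists_analyticAt_isTaylor {F : PowerSeries (PowerSeries ℝ)} {r C : ℝ} (hr : 0 < r)
    (hF : ∀ k i, |F.coeff₂ k i| * r ^ (k + i) ≤ C) :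
    ∃ f, AnalyticAt ℝ f 0 ∧ IsTaylor f F := by
  have hC : 0 ≤ C := le_trans (by positivity) (hF 0 0)
  have hbd : ∀ k i, |F.coeff₂ k i| ≤ C * (r⁻¹) ^ (k + i) := fun k i => by
    rw [inv_pow, ← div_eq_mul_inv, le_div_iff₀ (by positivity)]
    exact hF k i
  have hS : ∀ p : ℝ × ℝ, ‖p‖ < r / 2 → Summable (taylorTerm F p) := by
    rintro ⟨x, y⟩ hp
    rw [Prod.norm_def, max_lt_iff] at hp
    obtain ⟨hx, hy⟩ : |x| < r / 2 ∧ |y| < r / 2 := hp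
    have hg : Summable fun n : ℕ => ((1 : ℝ) / 2) ^ n := summable_geometric_two
    have hg2 := (hg.mul_of_nonneg hg (fun _ => by positivity) (fun _ => by positivity)).mul_left C
    refine Summable.of_norm_bounded hg2 ?_
    rintro ⟨k, i⟩
    simp only [taylorTerm, norm_mul, norm_pow, Real.norm_eq_abs]
    calc |F.coeff₂ k i| * (|y| ^ k * |x| ^ i)
        ≤ (C * (r⁻¹) ^ (k + i)) * ((r / 2) ^ k * (r / 2) ^ i) := by
          gcongr
          exact hbd k i
      _ = C * ((1 / 2) ^ k * (1 / 2) ^ i) := by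
          rw [pow_add, mul_assoc, mul_mul_mul_comm, ← mul_pow, ← mul_pow]
          have : r⁻¹ * (r / 2) = 1 / 2 := by field_simp
          rw [this]
  let M : (n : ℕ) → ℕ → ContinuousMultilinearMap ℝ (fun _ : Fin n => ℝ × ℝ) ℝ := fun n i =>
    (ContinuousMultilinearMap.mkPiAlgebra ℝ (Fin n) ℝ).compContinuousLinearMap
      (fun j => if (j : ℕ) < i then ContinuousLinearMap.fst ℝ ℝ ℝ
        else ContinuousLinearMap.snd ℝ ℝ ℝ)
  have hMn : ∀ n i, ‖M n i‖ ≤ 1 := by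
    intro n i
    refine ContinuousMultilinearMap.opNorm_le_bound zero_le_one fun m => ?_
    simp only [M, ContinuousMultilinearMap.compContinuousLinearMap_apply,
      ContinuousMultilinearMap.mkPiAlgebra_apply, norm_prod, one_mul]
    refine Finset.prod_le_prod (fun _ _ => norm_nonneg _) fun j _ => ?_
    split_ifs
    · exact norm_fst_le _
    · exact norm_snd_le _
  have hMv : ∀ k i (p : ℝ × ℝ), M (k + i) i (fun _ => p) = p.2 ^ k * p.1 ^ i := by
    intro k i p
    have h1 : ∀ j : Fin (k + i), (if (j : ℕ) < i then ContinuousLinearMap.fst ℝ ℝ ℝ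
        else ContinuousLinearMap.snd ℝ ℝ ℝ) p = (fun j : ℕ => if j < i then p.1 else p.2) j := by
      intro j
      dsimp only
      split_ifs <;> rfl
    simp only [M, ContinuousMultilinearMap.compContinuousLinearMap_apply,
      ContinuousMultilinearMap.mkPiAlgebra_apply, h1]
    rw [Fin.prod_univ_eq_prod_range (fun j : ℕ => if j < i then p.1 else p.2) (k + i), add_comm k i,
      Finset.prod_range_add, mul_comm]
    congr 1
    · simp
    · rw [Finset.prod_congr rfl (fun j hj => if_pos (Finset.mem_range.1 hj))]
      simp
  let P : FormalMultilinearSeries ℝ (ℝ × ℝ) ℝ := fun n =>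
    ∑ q ∈ Finset.HasAntidiagonal.antidiagonal n, F.coeff₂ q.1 q.2 • M n q.2
  have hPn : ∀ n, ‖P n‖ ≤ (n + 1) * (C * (r⁻¹) ^ n) := by
    intro n
    refine (norm_sum_le _ _).trans ?_
    have : ∀ q ∈ Finset.HasAntidiagonal.antidiagonal n,
        ‖F.coeff₂ q.1 q.2 • M n q.2‖ ≤ C * (r⁻¹) ^ n := by
      intro q hq
      rw [norm_smul, Real.norm_eq_abs]
      have h1 := hbd q.1 q.2
      rw [Finset.HasAntidiagonal.mem_antidiagonal.1 hq] at h1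
      calc _ ≤ (C * (r⁻¹) ^ n) * 1 := by gcongr; exact hMn _ _
        _ = _ := mul_one _
    refine (Finset.sum_le_card_nsmul _ _ _ this).trans (le_of_eq ?_)
    simp [Finset.Nat.card_antidiagonal]
  refine ⟨fun p => ∑' n, taylorTerm F p n, ?_, ?_⟩
  · refine ⟨P, ENNReal.ofReal (r / 2), ?_, by simpa using hr, ?_⟩
    · have : Summable fun n : ℕ => ‖P n‖ * ((r / 2).toNNReal : ℝ) ^ n := by
        have h1 : Summable fun n : ℕ => ((n : ℝ) + 1) * (1 / 2) ^ n := by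
          have h2 := summable_pow_mul_geometric_of_norm_lt_one 1
            (r := (1 / 2 : ℝ)) (by norm_num)
          have h3 : Summable fun n : ℕ => ((1 : ℝ) / 2) ^ n := summable_geometric_two
          refine (h2.add h3).congr fun n => ?_
          ring
        refine Summable.of_nonneg_of_le (fun n => by positivity) (fun n => ?_) (h1.mul_left C)
        rw [Real.coe_toNNReal _ (by positivity)]
        calc ‖P n‖ * (r / 2) ^ n ≤ ((n + 1) * (C * (r⁻¹) ^ n)) * (r / 2) ^ n := by
              gcongr
              exact hPn n
          _ = C * ((n + 1) * (1 / 2) ^ n) := by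
              have : r⁻¹ * (r / 2) = 1 / 2 := by field_simp
              rw [mul_assoc, mul_assoc, ← mul_pow, this]
              ring
      exact P.le_radius_of_summable this
    · intro p hp
      have hp' : ‖p‖ < r / 2 := by
        rw [Metric.mem_eball, edist_zero_right, ← ofReal_norm] at hp
        exact (ENNReal.ofReal_lt_ofReal_iff (by positivity)).1 hp
      rw [zero_add]
      have h1 := (hS p hp').hasSum
      rw [← Finset.HasAntidiagonal.sigmaAntidiagonalEquivProd.hasSum_iff] at h1
      refine (h1.sigma (fun n => hasSum_fintype _)).congr_fun ?_
      intro n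
      simp only [P, _root_.sum_apply, _root_.smul_apply]
      rw [← Finset.sum_coe_sort]
      refine Finset.sum_congr rfl fun q _ => ?_
      obtain ⟨⟨k, i⟩, hq⟩ := q
      obtain rfl : k + i = n := Finset.HasAntidiagonal.mem_antidiagonal.1 hq
      simp [hMv, taylorTerm]
  · rw [IsTaylor, Metric.eventually_nhds_iff]
    refine ⟨r / 2, by positivity, fun p hp => (hS p ?_).hasSum⟩
    simpa using hp

/-- The weighted `ℓ¹` norm of a power series. -/
noncomputable def PowerSeries.weightedNorm (r : ENNReal) (a : PowerSeries ℝ) : ENNReal :=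
  ∑' i, ‖PowerSeries.coeff i a‖ₑ * r ^ i

namespace PowerSeries

variable (r : ENNReal)

theorem weightedNorm_add_le (a b : PowerSeries ℝ) :
    weightedNorm r (a + b) ≤ weightedNorm r a + weightedNorm r b := by
  rw [weightedNorm, weightedNorm, weightedNorm, ← ENNReal.tsum_add]
  refine ENNReal.tsum_le_tsum fun i => ?_
  rw [← add_mul, map_add]
  gcongr
  exact enorm_add_le _ _

theorem weightedNorm_neg (a : PowerSeries ℝ) : weightedNorm r (-a) = weightedNorm r a := by
  simp [weightedNorm]

theorem weightedNorm_sum_le {ι : Type*} (s : Finset ι) (a : ι → PowerSeries ℝ) :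
    weightedNorm r (∑ i ∈ s, a i) ≤ ∑ i ∈ s, weightedNorm r (a i) := by
  classical
  induction s using Finset.induction_on with
  | empty => simp [weightedNorm]
  | insert j s hj ih =>
    rw [Finset.sum_insert hj, Finset.sum_insert hj]
    exact (weightedNorm_add_le r _ _).trans (by gcongr)

theorem weightedNorm_mul_le (a b : PowerSeries ℝ) :
    weightedNorm r (a * b) ≤ weightedNorm r a * weightedNorm r b := by
  have h : weightedNorm r a * weightedNorm r b = ∑' n : ℕ × ℕ,
      (‖coeff n.1 a‖ₑ * r ^ n.1) * (‖coeff n.2 b‖ₑ * r ^ n.2) := by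
    rw [weightedNorm, weightedNorm, ENNReal.tsum_prod
      (f := fun i j => (‖coeff i a‖ₑ * r ^ i) * (‖coeff j b‖ₑ * r ^ j))]
    simp_rw [ENNReal.tsum_mul_left, ENNReal.tsum_mul_right]
  rw [h, ← Finset.HasAntidiagonal.sigmaAntidiagonalEquivProd.tsum_eq, ENNReal.tsum_sigma',
    weightedNorm]
  refine ENNReal.tsum_le_tsum fun n => ?_
  rw [tsum_fintype, coeff_mul]
  refine (mul_le_mul_left (enorm_sum_le _ _) _).trans (le_of_eq ?_)
  rw [Finset.sum_mul, ← Finset.sum_coe_sort]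
  refine Finset.sum_congr rfl fun q _ => ?_
  obtain ⟨⟨k, i⟩, hq⟩ := q
  obtain rfl : k + i = n := Finset.HasAntidiagonal.mem_antidiagonal.1 hq
  simp only [enorm_mul, pow_add, Finset.HasAntidiagonal.sigmaAntidiagonalEquivProd_apply]
  ring

theorem weightedNorm_X_pow_mul (m : ℕ) (a : PowerSeries ℝ) :
    weightedNorm r (X ^ m * a) = r ^ m * weightedNorm r a := by
  rw [weightedNorm, weightedNorm, ← ENNReal.tsum_mul_left]
  have hinj : Function.Injective (fun i : ℕ => i + m) := add_left_injective m
  rw [← hinj.tsum_eq]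
  · refine tsum_congr fun i => ?_
    rw [coeff_X_pow_mul, pow_add]
    ring
  · intro i hi
    by_cases h : m ≤ i
    · exact ⟨i - m, Nat.sub_add_cancel h⟩
    · simp [coeff_X_pow_mul', h] at hi

theorem weightedNorm_coeff_le {F : PowerSeries (PowerSeries ℝ)} {r C : ℝ} (hr : 0 < r)
    (hF : ∀ k i, |F.coeff₂ k i| * r ^ (k + i) ≤ C) (k : ℕ) :
    weightedNorm (ENNReal.ofReal (r / 2)) (coeff k F) ≤
      ENNReal.ofReal (C * 2) * ENNReal.ofReal r⁻¹ ^ k := by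
  have hC : 0 ≤ C := le_trans (by positivity) (hF 0 0)
  have h : ∀ i, ‖coeff i (coeff k F)‖ₑ * ENNReal.ofReal (r / 2) ^ i ≤
      ENNReal.ofReal (C * r⁻¹ ^ k * (1 / 2) ^ i) := by
    intro i
    rw [← ofReal_norm, ← ENNReal.ofReal_pow (by positivity), ← ENNReal.ofReal_mul (by positivity)]
    refine ENNReal.ofReal_le_ofReal ?_
    have h1 := hF k i
    rw [coeff₂, pow_add, ← mul_assoc, mul_right_comm, ← le_div_iff₀ (by positivity)] at h1
    rw [Real.norm_eq_abs]
    calc _ = |coeff i (coeff k F)| * r ^ i * (1 / 2) ^ i := by ring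
      _ ≤ C / r ^ k * (1 / 2) ^ i := by gcongr
      _ = _ := by rw [inv_pow, div_eq_mul_inv]
  refine (ENNReal.tsum_le_tsum h).trans (le_of_eq ?_)
  rw [← ENNReal.ofReal_tsum_of_nonneg (fun i => by positivity)
    (summable_geometric_two.mul_left _), tsum_mul_left, tsum_geometric_two,
    ← ENNReal.ofReal_pow (by positivity), ← ENNReal.ofReal_mul (by positivity)]
  congr 1
  ring

theorem le_geometric_of_le_convolution {n : ℕ → ENNReal} {B τ : ENNReal}
    (h : ∀ k, n k ≤ B * (τ ^ k + ∑ j ∈ Finset.range k, n j * τ ^ (k - j))) (k : ℕ) :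
    n k ≤ B * (τ * (1 + B)) ^ k := by
  have hid : ∀ k, τ ^ k + ∑ j ∈ Finset.range k, B * (τ * (1 + B)) ^ j * τ ^ (k - j) =
      (τ * (1 + B)) ^ k := by
    intro k
    induction k with
    | zero => simp
    | succ k ih =>
      have h1 : ∑ j ∈ Finset.range k, B * (τ * (1 + B)) ^ j * τ ^ (k + 1 - j) =
          (∑ j ∈ Finset.range k, B * (τ * (1 + B)) ^ j * τ ^ (k - j)) * τ := by
        rw [Finset.sum_mul]
        refine Finset.sum_congr rfl fun j hj => ?_
        rw [Nat.succ_sub (Finset.mem_range.1 hj).le, pow_succ, mul_assoc _ _ τ]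
      rw [Finset.sum_range_succ, h1, pow_succ τ, pow_succ _ k, Nat.add_sub_cancel_left, pow_one,
        ← add_assoc, ← add_mul, ih]
      ring
  induction k using Nat.strong_induction_on with
  | _ k ih =>
    refine (h k).trans ?_
    rw [← hid k]
    gcongr with j hj
    exact ih j (Finset.mem_range.1 hj)

/-- If a double power series `F` is monic of degree `m` in `x` modulo `y`, then dividing by `F`
preserves convergence. -/
theorem exists_bound_of_eq_mul {F G Q : PowerSeries (PowerSeries ℝ)} {m : ℕ}
    (hF0 : coeff 0 F = X ^ m) (hG : G = F * Q)
    (hFb : ∃ r > 0, ∃ C, ∀ k i, |F.coeff₂ k i| * r ^ (k + i) ≤ C)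
    (hGb : ∃ r > 0, ∃ C, ∀ k i, |G.coeff₂ k i| * r ^ (k + i) ≤ C) :
    ∃ r > 0, ∃ C, ∀ k i, |Q.coeff₂ k i| * r ^ (k + i) ≤ C := by
  obtain ⟨r₁, hr₁, C₁, hF⟩ := hFb
  obtain ⟨r₂, hr₂, C₂, hG'⟩ := hGb
  obtain ⟨r, hr, C, hF, hG'⟩ : ∃ r > 0, ∃ C, (∀ k i, |F.coeff₂ k i| * r ^ (k + i) ≤ C) ∧
      ∀ k i, |G.coeff₂ k i| * r ^ (k + i) ≤ C := by
    refine ⟨min r₁ r₂, lt_min hr₁ hr₂, max C₁ C₂, fun k i => ?_, fun k i => ?_⟩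
    · refine le_trans ?_ ((hF k i).trans (le_max_left _ _))
      gcongr
      exact min_le_left _ _
    · refine le_trans ?_ ((hG' k i).trans (le_max_right _ _))
      gcongr
      exact min_le_right _ _
  set ρ := ENNReal.ofReal (r / 2) with hρ
  have hρ0 : ρ ^ m ≠ 0 := pow_ne_zero _ (by simpa [hρ] using hr)
  have hρt : ρ ^ m ≠ ⊤ := ENNReal.pow_ne_top (by simp [hρ])
  set K := ENNReal.ofReal (C * 2)
  set τ := ENNReal.ofReal r⁻¹
  set B := (ρ ^ m)⁻¹ * K
  have hB : B ≠ ⊤ := ENNReal.mul_ne_top (ENNReal.inv_ne_top.2 hρ0) (by simp [K])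
  have hrec : ∀ k, weightedNorm ρ (coeff k Q) ≤
      B * (τ ^ k + ∑ j ∈ Finset.range k, weightedNorm ρ (coeff j Q) * τ ^ (k - j)) := by
    intro k
    have h1 : X ^ m * coeff k Q =
        coeff k G + -∑ j ∈ Finset.range k, coeff j Q * coeff (k - j) F := by
      rw [hG, mul_comm F Q, coeff_mul, Finset.Nat.sum_antidiagonal_eq_sum_range_succ_mk,
        Finset.sum_range_succ, Nat.sub_self, hF0]
      ring
    have h2 : ρ ^ m * weightedNorm ρ (coeff k Q) ≤
        K * (τ ^ k + ∑ j ∈ Finset.range k, weightedNorm ρ (coeff j Q) * τ ^ (k - j)) := by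
      rw [← weightedNorm_X_pow_mul, h1]
      refine (weightedNorm_add_le _ _ _).trans ?_
      rw [mul_add, weightedNorm_neg, Finset.mul_sum]
      refine add_le_add (weightedNorm_coeff_le hr hG' k) ((weightedNorm_sum_le _ _ _).trans ?_)
      refine Finset.sum_le_sum fun j _ => (weightedNorm_mul_le _ _ _).trans ?_
      refine (mul_le_mul_right (weightedNorm_coeff_le hr hF (k - j)) _).trans (le_of_eq ?_)
      ring
    rw [mul_assoc]
    rw [← ENNReal.mul_le_mul_iff_right hρ0 hρt, ← mul_assoc (ρ ^ m), ENNReal.mul_inv_cancel hρ0 hρt,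
      one_mul]
    exact h2
  have hgeo := le_geometric_of_le_convolution hrec
  set t := (τ * (1 + B)) with ht
  have htt : t ≠ ⊤ := ENNReal.mul_ne_top (by simp [τ]) (by simp [hB])
  have hreal : ∀ k i, |Q.coeff₂ k i| * (r / 2) ^ i ≤ B.toReal * t.toReal ^ k := by
    intro k i
    have h1 : ‖Q.coeff₂ k i‖ₑ * ρ ^ i ≤ B * t ^ k := by
      refine le_trans ?_ (hgeo k)
      exact ENNReal.le_tsum (f := fun i => ‖coeff i (coeff k Q)‖ₑ * ρ ^ i) i
    have h2 := ENNReal.toReal_mono (ENNReal.mul_ne_top hB (ENNReal.pow_ne_top htt)) h1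
    rw [ENNReal.toReal_mul, ENNReal.toReal_mul, ENNReal.toReal_pow, ENNReal.toReal_pow,
      toReal_enorm, Real.norm_eq_abs, hρ, ENNReal.toReal_ofReal (by positivity)] at h2
    exact h2
  have ht0 : 0 ≤ t.toReal := ENNReal.toReal_nonneg
  refine ⟨min (r / 2) (t.toReal + 1)⁻¹, by positivity, B.toReal, fun k i => ?_⟩
  set s := min (r / 2) (t.toReal + 1)⁻¹
  have hs : 0 ≤ s := by positivity
  calc |Q.coeff₂ k i| * s ^ (k + i) = |Q.coeff₂ k i| * s ^ i * s ^ k := by ring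
    _ ≤ |Q.coeff₂ k i| * (r / 2) ^ i * s ^ k := by gcongr; exact min_le_left _ _
    _ ≤ B.toReal * t.toReal ^ k * ((t.toReal + 1)⁻¹) ^ k := by
      exact mul_le_mul (hreal k i) (pow_le_pow_left₀ hs (min_le_right _ _) k) (by positivity)
        (by positivity)
    _ = B.toReal * (t.toReal * (t.toReal + 1)⁻¹) ^ k := by rw [mul_pow, mul_assoc]
    _ ≤ B.toReal * 1 := by
      gcongr
      refine pow_le_one₀ (by positivity) ?_
      rw [← div_eq_mul_inv, div_le_one (by positivity)]
      linarith
    _ = B.toReal := mul_one _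

end PowerSeries

/-- The ring of germs of analytic functions of two variables is a domain. -/
theorem AnalyticAt.eventually_eq_zero_or_of_mul {f g : ℝ × ℝ → ℝ} (hf : AnalyticAt ℝ f 0)
    (hg : AnalyticAt ℝ g 0) (h : ∀ᶠ p in 𝓝 0, f p * g p = 0) :
    (∀ᶠ p in 𝓝 0, f p = 0) ∨ ∀ᶠ p in 𝓝 0, g p = 0 := by
  obtain ⟨F, hF⟩ := hf.exists_isTaylor
  obtain ⟨G, hG⟩ := hg.exists_isTaylor
  rcases mul_eq_zero.1 ((hF.mul hG).unique IsTaylor.zero h) with rfl | rfl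
  · exact Or.inl (hF.eventuallyEq IsTaylor.zero)
  · exact Or.inr (hG.eventuallyEq IsTaylor.zero)

theorem eventually_axis {P : ℝ × ℝ → Prop} (h : ∀ᶠ p in 𝓝 0, P p) :
    ∀ᶠ x in 𝓝 (0 : ℝ), P (x, 0) := by
  have : Continuous (fun x : ℝ => (x, (0 : ℝ))) := by fun_prop
  exact (this.tendsto 0).eventually h

theorem AnalyticAt.axis {f : ℝ × ℝ → ℝ} (hf : AnalyticAt ℝ f 0) :
    AnalyticAt ℝ (fun x => f (x, 0)) 0 :=
  AnalyticAt.fun_comp (g := f) (f := fun x : ℝ => (x, (0 : ℝ))) hf (by fun_prop)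

theorem IsTaylor.coeff_zero_congr {f g : ℝ × ℝ → ℝ} {F G : PowerSeries (PowerSeries ℝ)}
    (hf : IsTaylor f F) (hg : IsTaylor g G) (h : ∀ᶠ x in 𝓝 (0 : ℝ), f (x, 0) = g (x, 0)) :
    PowerSeries.coeff 0 F = PowerSeries.coeff 0 G := by
  rw [← sub_eq_zero, ← map_sub, (hf.sub hg).coeff_zero_eq_zero_iff]
  filter_upwards [h] with x hx using sub_eq_zero.2 hx

/-- The formal quotient of convergent power series converges, provided that the divisor does not
vanish identically on the first axis. -/
theorem IsTaylor.exists_of_mul {f g : ℝ × ℝ → ℝ} {F Q : PowerSeries (PowerSeries ℝ)}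
    (hf : AnalyticAt ℝ f 0) (hF : IsTaylor f F) (hG : IsTaylor g (F * Q))
    (hax : ¬ ∀ᶠ x in 𝓝 (0 : ℝ), f (x, 0) = 0) : ∃ q, AnalyticAt ℝ q 0 ∧ IsTaylor q Q := by
  have hord : analyticOrderAt (fun x => f (x, 0)) 0 ≠ ⊤ := by rwa [Ne, analyticOrderAt_eq_top]
  obtain ⟨u, hu, hu0, hfu⟩ := (hf.axis.analyticOrderAt_ne_top).1 hord
  set m := analyticOrderNatAt (fun x => f (x, 0)) 0
  have hv : AnalyticAt ℝ (fun p : ℝ × ℝ => (u p.1)⁻¹) 0 :=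
    AnalyticAt.inv (f := fun p : ℝ × ℝ => u p.1)
      (AnalyticAt.fun_comp (g := u) (f := fun p : ℝ × ℝ => p.1) hu analyticAt_fst) hu0
  obtain ⟨V, hV⟩ := hv.exists_isTaylor
  have h0 : PowerSeries.coeff 0 (F * V) = PowerSeries.X ^ m := by
    rw [(hF.mul hV).coeff_zero_congr (IsTaylor.monomial 0 m)]
    · simp
    · filter_upwards [hfu, hu.continuousAt.eventually_ne hu0] with x hx hxu
      simp only [sub_zero, smul_eq_mul] at hx
      simp only [hx, pow_zero, one_mul]
      field_simp
  obtain ⟨r, hr, C, hb⟩ := PowerSeries.exists_bound_of_eq_mul h0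
    (G := F * Q * V) (Q := Q) (by ring) (hF.mul hV).exists_bound (hG.mul hV).exists_bound
  exact exists_analyticAt_isTaylor hr hb

theorem dvd_of_monic_relation {R : Type*} [CommRing R] [IsDomain R] [IsIntegrallyClosed R]
    {a b : R} (ha : a ≠ 0) {l : ℕ} {e : ℕ → R}
    (h : b ^ l + ∑ i ∈ Finset.range l, e i * a ^ (l - i) * b ^ i = 0) : a ∣ b := by
  have key : ∀ (K : Type _) [Field K] [Algebra R K] [IsFractionRing R K], a ∣ b := by
    intro K _ _ _
    set φ := algebraMap R K
    have hφ : φ a ≠ 0 := fun h0 => ha (IsFractionRing.injective R K (by rw [h0, map_zero]))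
    have hquot : IsIntegral R (φ b / φ a) := by
      refine ⟨Polynomial.X ^ l + ∑ i ∈ Finset.range l, Polynomial.C (e i) * Polynomial.X ^ i,
        ?_, ?_⟩
      · refine Polynomial.monic_X_pow_add ((Polynomial.degree_sum_le _ _).trans_lt ?_)
        refine (Finset.sup_lt_iff (WithBot.bot_lt_coe l)).2 fun i hi => ?_
        exact (Polynomial.degree_C_mul_X_pow_le i _).trans_lt
          (WithBot.coe_lt_coe.2 (Finset.mem_range.1 hi))
      · have h1 := congrArg φ h
        simp only [map_add, map_sum, map_mul, map_pow, map_zero] at h1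
        simp only [Polynomial.eval₂_add, Polynomial.eval₂_finsetSum, Polynomial.eval₂_mul,
          Polynomial.eval₂_pow, Polynomial.eval₂_X, Polynomial.eval₂_C]
        have h2 : φ a ^ l * ((φ b / φ a) ^ l + ∑ i ∈ Finset.range l, φ (e i) * (φ b / φ a) ^ i)
            = 0 := by
          rw [← h1, mul_add, Finset.mul_sum]
          congr 1
          · rw [← mul_pow, mul_div_cancel₀ _ hφ]
          · refine Finset.sum_congr rfl fun i hi => ?_
            have : φ a ^ l = φ a ^ (l - i) * φ a ^ i := by
              rw [← pow_add, Nat.sub_add_cancel (Finset.mem_range.1 hi).le]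
            have h3 : φ b ^ i = φ a ^ i * (φ b / φ a) ^ i := by
              rw [← mul_pow, mul_div_cancel₀ _ hφ]
            rw [this, h3]
            ring
        exact (mul_eq_zero.1 h2).resolve_left (pow_ne_zero _ hφ)
    obtain ⟨q, hq⟩ := IsIntegrallyClosed.isIntegral_iff.1 hquot
    refine ⟨q, IsFractionRing.injective R K ?_⟩
    rw [map_mul, hq]
    exact (mul_div_cancel₀ _ hφ).symm
  exact key (FractionRing R)

/-- The ring of germs of analytic functions of two variables is integrally closed: if `g / f`
satisfies a monic equation, then `f` divides `g`. -/
theorem AnalyticAt.exists_eq_mul_of_monic_relation {f g : ℝ × ℝ → ℝ} (hf : AnalyticAt ℝ f 0)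
    (hg : AnalyticAt ℝ g 0) (hax : ¬ ∀ᶠ x in 𝓝 (0 : ℝ), f (x, 0) = 0) {l : ℕ}
    {e : ℕ → ℝ × ℝ → ℝ} (he : ∀ i, AnalyticAt ℝ (e i) 0)
    (h : ∀ᶠ p in 𝓝 0, g p ^ l + ∑ i ∈ Finset.range l, e i p * f p ^ (l - i) * g p ^ i = 0) :
    ∃ q, AnalyticAt ℝ q 0 ∧ ∀ᶠ p in 𝓝 0, g p = f p * q p := by
  obtain ⟨F, hF⟩ := hf.exists_isTaylor
  obtain ⟨G, hG⟩ := hg.exists_isTaylor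
  choose E hE using fun i => (he i).exists_isTaylor
  have hrel : G ^ l + ∑ i ∈ Finset.range l, E i * F ^ (l - i) * G ^ i = 0 :=
    ((hG.pow l).add (IsTaylor.sum _ fun i _ =>
      ((hE i).mul (hF.pow (l - i))).mul (hG.pow i))).unique IsTaylor.zero h
  have hF0 : F ≠ 0 := by
    rintro rfl
    exact hax ((hF.coeff_zero_eq_zero_iff).1 (map_zero _))
  obtain ⟨Q, rfl⟩ : F ∣ G := dvd_of_monic_relation hF0 hrel
  obtain ⟨q, hq, hQ⟩ := IsTaylor.exists_of_mul hf hF hG hax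
  exact ⟨q, hq, hG.eventuallyEq (hF.mul hQ)⟩

/-- A nonzero germ is a power of the second coordinate times a germ that does not vanish identically
on the first axis. -/
theorem AnalyticAt.exists_eq_snd_pow_mul {f : ℝ × ℝ → ℝ} (hf : AnalyticAt ℝ f 0)
    (h0 : ¬ ∀ᶠ p in 𝓝 0, f p = 0) : ∃ (k : ℕ) (g : ℝ × ℝ → ℝ), AnalyticAt ℝ g 0 ∧
      (¬ ∀ᶠ x in 𝓝 (0 : ℝ), g (x, 0) = 0) ∧ ∀ᶠ p in 𝓝 0, f p = p.2 ^ k * g p := by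
  obtain ⟨F, hF⟩ := hf.exists_isTaylor
  have hF0 : F ≠ 0 := by
    rintro rfl
    exact h0 (hF.eventuallyEq IsTaylor.zero)
  obtain ⟨G, hG⟩ := PowerSeries.X_pow_order_dvd (φ := F)
  set k := F.order.toNat
  obtain ⟨r, hr, C, hb⟩ := hF.exists_bound
  have hcoeff : ∀ j, PowerSeries.coeff j G = PowerSeries.coeff (j + k) F := by
    intro j
    conv_rhs => rw [hG]
    rw [PowerSeries.coeff_X_pow_mul]
  obtain ⟨g, hg, hgG⟩ := exists_analyticAt_isTaylor (F := G) (r := r) (C := C / r ^ k) hr (by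
    intro j i
    rw [le_div_iff₀ (by positivity), mul_assoc, ← pow_add, PowerSeries.coeff₂, hcoeff]
    rw [show j + i + k = j + k + i by ring]
    exact hb (j + k) i)
  refine ⟨k, g, hg, ?_, hF.eventuallyEq ?_⟩
  · rw [← hgG.coeff_zero_eq_zero_iff, hcoeff, zero_add]
    exact PowerSeries.coeff_order hF0
  · have := (IsTaylor.monomial k 0).mul hgG
    simpa [← hG] using this

theorem AnalyticAt.fderiv_apply {f : ℝ × ℝ → ℝ} {p : ℝ × ℝ} (hf : AnalyticAt ℝ f p) (v : ℝ × ℝ) :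
    AnalyticAt ℝ (fun p => fderiv ℝ f p v) p :=
  ((ContinuousLinearMap.apply ℝ ℝ v).analyticAt _).comp hf.fderiv

theorem AnalyticAt.eventually_differentiableAt {f : ℝ × ℝ → ℝ} {p : ℝ × ℝ}
    (hf : AnalyticAt ℝ f p) : ∀ᶠ q in 𝓝 p, DifferentiableAt ℝ f q :=
  hf.eventually_analyticAt.mono fun _ h => h.differentiableAt

/-- The germ `h` is analytic at the origin and the Jacobian of `f` and `h` vanishes near it. -/
structure JacobianNull (f h : ℝ × ℝ → ℝ) : Prop where
  analyticAt : AnalyticAt ℝ h 0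
  eventually_eq : ∀ᶠ p in 𝓝 0,
    fderiv ℝ f p (1, 0) * fderiv ℝ h p (0, 1) = fderiv ℝ f p (0, 1) * fderiv ℝ h p (1, 0)

namespace JacobianNull

variable {f g h : ℝ × ℝ → ℝ}

theorem refl (hf : AnalyticAt ℝ f 0) : JacobianNull f f :=
  ⟨hf, Filter.Eventually.of_forall fun _ => mul_comm _ _⟩

theorem congr (hh : JacobianNull f h) (hgh : h =ᶠ[𝓝 0] g) : JacobianNull f g := by
  refine ⟨hh.analyticAt.congr hgh, ?_⟩
  filter_upwards [hh.eventually_eq, hgh.fderiv (𝕜 := ℝ)] with p h1 h2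
  rwa [← h2]

theorem const (c : ℝ) : JacobianNull f (fun _ => c) :=
  ⟨analyticAt_const, Filter.Eventually.of_forall fun p => by simp⟩

theorem add (hg : JacobianNull f g) (hh : JacobianNull f h) :
    JacobianNull f (fun p => g p + h p) := by
  refine ⟨hg.analyticAt.add hh.analyticAt, ?_⟩
  filter_upwards [hg.eventually_eq, hh.eventually_eq, hg.analyticAt.eventually_differentiableAt,
    hh.analyticAt.eventually_differentiableAt] with p h1 h2 h3 h4
  rw [fderiv_fun_add h3 h4, _root_.add_apply, _root_.add_apply]
  linear_combination h1 + h2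

theorem mul (hg : JacobianNull f g) (hh : JacobianNull f h) :
    JacobianNull f (fun p => g p * h p) := by
  refine ⟨hg.analyticAt.mul hh.analyticAt, ?_⟩
  filter_upwards [hg.eventually_eq, hh.eventually_eq, hg.analyticAt.eventually_differentiableAt,
    hh.analyticAt.eventually_differentiableAt] with p h1 h2 h3 h4
  rw [fderiv_fun_mul h3 h4]
  simp only [_root_.add_apply, _root_.smul_apply, smul_eq_mul]
  linear_combination h p * h1 + g p * h2

theorem sub (hg : JacobianNull f g) (hh : JacobianNull f h) :
    JacobianNull f (fun p => g p - h p) := by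
  simpa [sub_eq_add_neg] using hg.add ((const (-1)).mul hh)

theorem pow (hg : JacobianNull f g) (n : ℕ) : JacobianNull f (fun p => g p ^ n) := by
  induction n with
  | zero => simpa using const (f := f) 1
  | succ n ih => simpa [pow_succ] using ih.mul hg

theorem sum {ι : Type*} (s : Finset ι) {h : ι → ℝ × ℝ → ℝ} (hh : ∀ i ∈ s, JacobianNull f (h i)) :
    JacobianNull f (fun p => ∑ i ∈ s, h i p) := by
  classical
  induction s using Finset.induction_on with
  | empty => simpa using const (f := f) 0
  | insert a s ha ih =>
    simp only [Finset.sum_insert ha]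
    exact (hh a (by simp)).add (ih fun i hi => hh i (by simp [hi]))

theorem comp {e : ℝ → ℝ} (hh : JacobianNull f h) (he : AnalyticAt ℝ e (h 0)) :
    JacobianNull f (fun p => e (h p)) := by
  refine ⟨he.fun_comp hh.analyticAt, ?_⟩
  filter_upwards [hh.eventually_eq, hh.analyticAt.eventually_differentiableAt,
    hh.analyticAt.continuousAt.eventually he.eventually_analyticAt] with p h1 h2 h3
  have h4 := (h3.differentiableAt.hasDerivAt.comp_hasFDerivAt p h2.hasFDerivAt).fderiv
  simp only [Function.comp_def] at h4
  rw [h4, _root_.smul_apply, _root_.smul_apply, smul_eq_mul, smul_eq_mul]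
  linear_combination deriv e (h p) * h1

theorem of_mul (hf : AnalyticAt ℝ f 0) (hg : JacobianNull f g) (hh : AnalyticAt ℝ h 0)
    (hgh : JacobianNull f (fun p => g p * h p)) (h0 : ¬ ∀ᶠ p in 𝓝 0, g p = 0) :
    JacobianNull f h := by
  refine ⟨hh, ?_⟩
  have han : AnalyticAt ℝ (fun p => fderiv ℝ f p (1, 0) * fderiv ℝ h p (0, 1) -
      fderiv ℝ f p (0, 1) * fderiv ℝ h p (1, 0)) 0 :=
    ((hf.fderiv_apply _).mul (hh.fderiv_apply _)).sub ((hf.fderiv_apply _).mul (hh.fderiv_apply _))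
  have := (hg.analyticAt.eventually_eq_zero_or_of_mul han ?_).resolve_left h0
  · exact this.mono fun p hp => sub_eq_zero.1 hp
  filter_upwards [hg.eventually_eq, hgh.eventually_eq, hg.analyticAt.eventually_differentiableAt,
    hh.eventually_differentiableAt] with p h1 h2 h3 h4
  rw [fderiv_fun_mul h3 h4] at h2
  simp only [_root_.add_apply, _root_.smul_apply, smul_eq_mul] at h2
  linear_combination h2 - h p * h1

/-- A germ functionally dependent on `f` is determined by its restriction to the first axis, if
`f` is not constant there. -/
theorem eventually_eq_zero (hf : AnalyticAt ℝ f 0)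
    (hfc : ¬ ∀ᶠ x in 𝓝 (0 : ℝ), f (x, 0) = f (0, 0)) (hh : JacobianNull f h)
    (hax : ∀ᶠ x in 𝓝 (0 : ℝ), h (x, 0) = 0) : ∀ᶠ p in 𝓝 0, h p = 0 := by
  by_contra hcon
  obtain ⟨k, g, hg, hg0, hhg⟩ := hh.analyticAt.exists_eq_snd_pow_mul hcon
  obtain _ | j := k
  · refine hg0 ?_
    filter_upwards [hax, eventually_axis hhg] with x h1 h2
    simpa [h1] using h2.symm
  have hb : AnalyticAt ℝ (fun p : ℝ × ℝ =>
      fderiv ℝ f p (1, 0) * ((j + 1) * g p + p.2 * fderiv ℝ g p (0, 1)) -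
        fderiv ℝ f p (0, 1) * (p.2 * fderiv ℝ g p (1, 0))) 0 :=
    ((hf.fderiv_apply _).mul ((analyticAt_const.mul hg).add
      (analyticAt_snd.mul (hg.fderiv_apply _)))).sub
      ((hf.fderiv_apply _).mul (analyticAt_snd.mul (hg.fderiv_apply _)))
  have hy : AnalyticAt ℝ (fun p : ℝ × ℝ => p.2 ^ j) 0 := analyticAt_snd.pow j
  have hmul : ∀ᶠ p : ℝ × ℝ in 𝓝 0, p.2 ^ j *
      (fderiv ℝ f p (1, 0) * ((j + 1) * g p + p.2 * fderiv ℝ g p (0, 1)) -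
        fderiv ℝ f p (0, 1) * (p.2 * fderiv ℝ g p (1, 0))) = 0 := by
    have h1 : h =ᶠ[𝓝 0] fun p => p.2 ^ (j + 1) * g p := hhg
    filter_upwards [hh.eventually_eq, h1.fderiv (𝕜 := ℝ), hg.eventually_differentiableAt]
      with p h2 h3 h4
    have h5 : HasFDerivAt (fun p : ℝ × ℝ => p.2 ^ (j + 1))
        (((j + 1 : ℕ) * p.2 ^ j) • ContinuousLinearMap.snd ℝ ℝ ℝ) p := by
      simpa using (hasFDerivAt_snd (𝕜 := ℝ) (p := p)).pow (j + 1)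
    rw [h3, (h5.fun_mul h4.hasFDerivAt).fderiv] at h2
    simp only [_root_.add_apply, _root_.smul_apply, smul_eq_mul,
      ContinuousLinearMap.coe_snd', Nat.cast_add, Nat.cast_one] at h2
    linear_combination h2
  have hbr := (hy.eventually_eq_zero_or_of_mul hb hmul).resolve_left (by
    intro h0
    have h1 := (IsTaylor.monomial j 0).unique IsTaylor.zero 
      (h0.mono fun p hp => by simpa only [pow_zero, mul_one] using hp)
    simp at h1)
  have hprod : ∀ᶠ x in 𝓝 (0 : ℝ), fderiv ℝ f (x, 0) (1, 0) * g (x, 0) = 0 := by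
    filter_upwards [eventually_axis hbr] with x hx
    have hj : (j : ℝ) + 1 ≠ 0 := by positivity
    have : ((j : ℝ) + 1) * (fderiv ℝ f (x, 0) (1, 0) * g (x, 0)) = 0 := by
      linear_combination hx
    exact (mul_eq_zero.1 this).resolve_left hj
  have hord : analyticOrderAt (fun x : ℝ => fderiv ℝ f (x, 0) (1, 0)) 0 +
      analyticOrderAt (fun x : ℝ => g (x, 0)) 0 = ⊤ := by
    rw [← analyticOrderAt_mul (hf.fderiv_apply (1, 0)).axis hg.axis]
    exact analyticOrderAt_eq_top.2 hprod
  rcases ENat.add_eq_top.1 hord with h1 | h1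
  · refine hfc ?_
    rw [analyticOrderAt_eq_top] at h1
    obtain ⟨ε, hε, hball⟩ := Metric.eventually_nhds_iff_ball.1
      (h1.and (eventually_axis hf.eventually_differentiableAt))
    have hd : ∀ x ∈ ball (0 : ℝ) ε, HasDerivAt (fun x => f (x, 0)) 0 x := by
      intro x hx
      obtain ⟨h2, h3⟩ := hball x hx
      have h4 : HasDerivAt (fun x : ℝ => (x, (0 : ℝ))) (1, 0) x :=
        (hasDerivAt_id x).prodMk (hasDerivAt_const x 0)
      have h5 := h3.hasFDerivAt.comp_hasDerivAt x h4
      rwa [h2] at h5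
    filter_upwards [ball_mem_nhds (0 : ℝ) hε] with x hx
    exact (isOpen_ball).is_const_of_deriv_eq_zero (convex_ball (0 : ℝ) ε).isPreconnected
      (fun y hy => (hd y hy).differentiableAt.differentiableWithinAt)
      (fun y hy => (hd y hy).deriv) hx (mem_ball_self hε)
  · exact hg0 (analyticOrderAt_eq_top.1 h1)

end JacobianNull

theorem AnalyticAt.exists_coeff {b : ℝ → ℝ} (hb : AnalyticAt ℝ b 0) :
    ∃ β : ℕ → ℝ, ∀ᶠ t in 𝓝 (0 : ℝ), HasSum (fun n => β n * t ^ n) (b t) := by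
  obtain ⟨p, hp⟩ := hb
  refine ⟨p.coeff, ?_⟩
  filter_upwards [hasFPowerSeriesAt_iff.1 hp] with t ht
  simpa [mul_comm] using ht

theorem AnalyticAt.of_hasSum {b : ℝ → ℝ} {β : ℕ → ℝ}
    (h : ∀ᶠ t in 𝓝 (0 : ℝ), HasSum (fun n => β n * t ^ n) (b t)) : AnalyticAt ℝ b 0 := by
  refine ⟨FormalMultilinearSeries.ofScalars ℝ β, ?_⟩
  rw [hasFPowerSeriesAt_iff]
  filter_upwards [h] with x hx
  simpa [FormalMultilinearSeries.coeff_ofScalars, mul_comm] using hx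

/-- Splitting a convergent power series according to the residues of its exponents modulo `d`. -/
theorem AnalyticAt.exists_eq_sum_pow_mul_comp_pow {b : ℝ → ℝ} (hb : AnalyticAt ℝ b 0) {d : ℕ}
    (hd : d ≠ 0) : ∃ c : ℕ → ℝ → ℝ, (∀ i, AnalyticAt ℝ (c i) 0) ∧
      ∀ᶠ t in 𝓝 (0 : ℝ), b t = ∑ i ∈ Finset.range d, t ^ i * c i (t ^ d) := by
  obtain ⟨β, hβ⟩ := hb.exists_coeff
  obtain ⟨ε, hε, h⟩ := Metric.eventually_nhds_iff.1 hβ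
  have hε2 : dist (ε / 2) 0 < ε := by
    rw [dist_zero_right, Real.norm_eq_abs, abs_of_pos (by positivity)]
    linarith
  set r := ε / 2 with hr
  have hr0 : 0 < r := by positivity
  obtain ⟨C, hC⟩ : ∃ C, ∀ n, |β n| * r ^ n ≤ C := by
    refine ⟨∑' n, |β n * r ^ n|, fun n => ?_⟩
    refine le_trans (le_of_eq ?_) ((h hε2).summable.abs.le_tsum n fun _ _ => abs_nonneg _)
    rw [abs_mul, abs_of_nonneg (pow_nonneg hr0.le n)]
  have hs : ∀ i, ∀ᶠ u in 𝓝 (0 : ℝ), Summable fun q => β (q * d + i) * u ^ q := by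
    intro i
    have hpos : 0 < r ^ d / 2 := by positivity
    filter_upwards [Metric.ball_mem_nhds (0 : ℝ) hpos] with u hu
    have hu' : |u| ≤ r ^ d / 2 := by simpa using (mem_ball_zero_iff.1 hu).le
    refine Summable.of_norm_bounded (summable_geometric_two.mul_left (C / r ^ i)) fun q => ?_
    rw [norm_mul, norm_pow, Real.norm_eq_abs, Real.norm_eq_abs]
    have h1 : |β (q * d + i)| * (r ^ d) ^ q ≤ C / r ^ i := by
      rw [le_div_iff₀ (by positivity), mul_assoc, ← pow_mul, ← pow_add, mul_comm d q]
      exact hC _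
    calc _ ≤ |β (q * d + i)| * (r ^ d / 2) ^ q := by gcongr
      _ = |β (q * d + i)| * (r ^ d) ^ q * (1 / 2) ^ q := by ring
      _ ≤ _ := by gcongr
  refine ⟨fun i u => ∑' q, β (q * d + i) * u ^ q, fun i => ?_, ?_⟩
  · exact AnalyticAt.of_hasSum ((hs i).mono fun u hu => hu.hasSum)
  · have hpow : Filter.Tendsto (fun t : ℝ => t ^ d) (𝓝 0) (𝓝 0) := by
      have : Continuous fun t : ℝ => t ^ d := by fun_prop
      simpa [hd] using this.tendsto 0
    have hs' := (Finset.eventually_all (Finset.range d)).2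
      fun i _ => hpow.eventually (hs i)
    filter_upwards [hβ, hs'] with t ht hst
    have : NeZero d := ⟨hd⟩
    have h1 := ((Nat.divModEquiv d).symm.hasSum_iff.2 ht).prod_fiberwise
      fun q => hasSum_fintype _
    have h2 : HasSum (fun q => ∑ i ∈ Finset.range d, t ^ i * (β (q * d + i) * (t ^ d) ^ q))
        (∑ i ∈ Finset.range d, t ^ i * ∑' q, β (q * d + i) * (t ^ d) ^ q) :=
      hasSum_sum fun i hi => (hst i hi).hasSum.mul_left _
    refine h1.unique (h2.congr_fun fun q => ?_)
    rw [← Fin.sum_univ_eq_sum_range (fun i => t ^ i * (β (q * d + i) * (t ^ d) ^ q))]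
    refine Finset.sum_congr rfl fun i _ => ?_
    simp only [Function.comp_apply, Nat.divModEquiv_symm_apply]
    ring

/-- The ring of germs of analytic functions on the line is generated over the germs composed with
`a` by the powers of a suitable local coordinate. -/
theorem AnalyticAt.exists_coordinate_decomposition {a : ℝ → ℝ} (ha : AnalyticAt ℝ a 0) {d : ℕ}
    (hd : d ≠ 0) (hord : analyticOrderAt a 0 = d) :
    ∃ s : ℝ → ℝ, AnalyticAt ℝ s 0 ∧ analyticOrderAt s 0 = 1 ∧ ∀ b, AnalyticAt ℝ b 0 →
      ∃ c : ℕ → ℝ → ℝ, (∀ i, AnalyticAt ℝ (c i) 0) ∧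
        ∀ᶠ x in 𝓝 (0 : ℝ), b x = ∑ i ∈ Finset.range d, s x ^ i * c i (a x) := by
  obtain ⟨u, hu, hu0, hau⟩ := (ha.analyticOrderAt_eq_natCast).1 hord
  obtain ⟨ε, hε, hεu⟩ : ∃ ε : ℝ, ε * ε = 1 ∧ 0 < ε * u 0 := by
    rcases lt_or_gt_of_ne hu0 with h | h
    · exact ⟨-1, by norm_num, by linarith⟩
    · exact ⟨1, by norm_num, by linarith⟩
  have hw : AnalyticAt ℝ (fun x => Real.exp (Real.log (ε * u x) / d)) 0 :=
    (((analyticAt_const.mul hu).log hεu).div_const).rexp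
  set w := fun x => Real.exp (Real.log (ε * u x) / d)
  have hw0 : w 0 ≠ 0 := (Real.exp_pos _).ne'
  have hs : AnalyticAt ℝ (fun x => x * w x) 0 := analyticAt_id.mul hw
  set s := fun x => x * w x with hsdef
  have hs0 : s 0 = 0 := zero_mul _
  have hsd : ∀ᶠ x in 𝓝 (0 : ℝ), s x ^ d = ε * a x := by
    have hpos : ∀ᶠ x in 𝓝 (0 : ℝ), 0 < ε * u x :=
      (continuousAt_const.mul hu.continuousAt).eventually (lt_mem_nhds hεu)
    filter_upwards [hau, hpos]
      with x h1 h2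
    have h3 : w x ^ d = ε * u x := by
      rw [← Real.exp_nat_mul, mul_div_cancel₀ _ (by exact_mod_cast hd), Real.exp_log h2]
    rw [hsdef, mul_pow, h3, h1, sub_zero, smul_eq_mul]
    ring
  have hsord : analyticOrderAt s 0 = 1 := by
    refine (hs.analyticOrderAt_eq_natCast (n := 1)).2 ⟨w, hw, hw0, ?_⟩
    exact Filter.Eventually.of_forall fun x => by simp [hsdef]
  have hderiv : deriv s 0 ≠ 0 := by
    have : HasDerivAt s (1 * w 0 + 0 * deriv w 0) 0 :=
      (hasDerivAt_id 0).mul hw.differentiableAt.hasDerivAt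
    rw [this.deriv]
    simpa using hw0
  have hinv := hs.analyticAt_localInverse hderiv
  have hleft := hs.hasStrictDerivAt.eventually_left_inverse hderiv
  set ψ := hs.hasStrictDerivAt.localInverse s _ 0 hderiv
  rw [hs0] at hinv
  have hψ0 : ψ 0 = 0 := by
    have := hleft.self_of_nhds
    rwa [hs0] at this
  refine ⟨s, hs, hsord, fun b hb => ?_⟩
  have hbψ : AnalyticAt ℝ (fun t => b (ψ t)) 0 :=
    AnalyticAt.fun_comp (by rwa [hψ0]) hinv
  obtain ⟨c, hc, hsum⟩ := hbψ.exists_eq_sum_pow_mul_comp_pow hd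
  refine ⟨fun i t => c i (ε * t), fun i => ?_, ?_⟩
  · exact AnalyticAt.fun_comp (by simpa using hc i) (by fun_prop)
  · have hst : Filter.Tendsto s (𝓝 0) (𝓝 0) := by
      have := hs.continuousAt.tendsto
      rwa [hs0] at this
    filter_upwards [hst.eventually hsum, hleft, hsd] with x h1 h2 h3
    rw [h2] at h1
    rw [h1, h3]

theorem AnalyticAt.charpoly_coeff {n : ℕ} {M : ℝ → Matrix (Fin n) (Fin n) ℝ} {z : ℝ}
    (hM : ∀ j k, AnalyticAt ℝ (fun t => M t j k) z) (i : ℕ) :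
    AnalyticAt ℝ (fun t => (M t).charpoly.coeff i) z := by
  have h := AnalyticAt.aeval_mvPolynomial (A := ℝ)
    (f := fun t (jk : Fin n × Fin n) => M t jk.1 jk.2) (fun jk => hM jk.1 jk.2)
    ((charpoly.univ ℝ (Fin n)).coeff i)
  refine h.congr (Filter.Eventually.of_forall fun t => ?_)
  exact charpoly.univ_coeff_eval₂Hom (Fin n) (algebraMap ℝ ℝ)
    (fun jk : Fin n × Fin n => M t jk.1 jk.2) i

/-- Germs of analytic functions on the line are integral over the germs composed with `a`. -/
theorem AnalyticAt.exists_monic_relation {a q : ℝ → ℝ} (ha : AnalyticAt ℝ a 0)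
    {d : ℕ} (hd : d ≠ 0) (hord : analyticOrderAt a 0 = d) (hq : AnalyticAt ℝ q 0) :
    ∃ e : ℕ → ℝ → ℝ, (∀ i, AnalyticAt ℝ (e i) 0) ∧
      ∀ᶠ x in 𝓝 (0 : ℝ), q x ^ d + ∑ i ∈ Finset.range d, e i (a x) * q x ^ i = 0 := by
  obtain ⟨s, hs, -, hdec⟩ := ha.exists_coordinate_decomposition hd hord
  choose c hc hsum using fun j : ℕ => hdec (fun x => q x * s x ^ j) (hq.mul (hs.pow j))
  let M : ℝ → Matrix (Fin d) (Fin d) ℝ := fun t => Matrix.of fun j i => c j i t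
  refine ⟨fun i t => (M t).charpoly.coeff i, fun i => ?_, ?_⟩
  · exact AnalyticAt.charpoly_coeff (fun j k => hc j k) i
  · have hall : ∀ᶠ x in 𝓝 (0 : ℝ), ∀ j ∈ Finset.range d,
        q x * s x ^ j = ∑ i ∈ Finset.range d, s x ^ i * c j i (a x) :=
      (Finset.eventually_all (Finset.range d)).2 fun j _ => hsum j
    filter_upwards [hall] with x hx
    have hdet : (Matrix.scalar (Fin d) (q x) - M (a x)).det = 0 := by
      rw [← Matrix.exists_mulVec_eq_zero_iff]
      refine ⟨fun i => s x ^ (i : ℕ), fun h => ?_, ?_⟩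
      · simpa using congrFun h ⟨0, Nat.pos_of_ne_zero hd⟩
      · ext j
        have h1 := hx j (Finset.mem_range.2 j.2)
        rw [← Fin.sum_univ_eq_sum_range (fun i => s x ^ i * c j i (a x))] at h1
        simp only [Matrix.sub_mulVec, Pi.sub_apply, Pi.zero_apply, sub_eq_zero]
        rw [Matrix.scalar_apply, Matrix.mulVec_diagonal, h1]
        refine Finset.sum_congr rfl fun i _ => mul_comm _ _
    rw [← Matrix.eval_charpoly, Polynomial.eval_eq_sum_range, Matrix.charpoly_natDegree_eq_dim,
      Fintype.card_fin, Finset.sum_range_succ] at hdet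
    have hmonic := (Matrix.charpoly_monic (M (a x))).coeff_natDegree
    rw [Matrix.charpoly_natDegree_eq_dim, Fintype.card_fin] at hmonic
    rw [hmonic] at hdet
    linarith

/-- Division in the ring of germs of analytic functions on the line. -/
theorem AnalyticAt.exists_eq_mul_of_analyticOrderAt_le {a b : ℝ → ℝ} (ha : AnalyticAt ℝ a 0)
    (hb : AnalyticAt ℝ b 0) (ha0 : analyticOrderAt a 0 ≠ ⊤)
    (hab : analyticOrderAt a 0 ≤ analyticOrderAt b 0) :
    ∃ q, AnalyticAt ℝ q 0 ∧ ∀ᶠ x in 𝓝 0, b x = a x * q x := by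
  obtain ⟨m, hm⟩ := ENat.ne_top_iff_exists.1 ha0
  obtain ⟨u, hu, hu0, hau⟩ := (ha.analyticOrderAt_eq_natCast).1 hm.symm
  rw [← hm, natCast_le_analyticOrderAt hb] at hab
  obtain ⟨v, hv, hbv⟩ := hab
  refine ⟨fun x => v x / u x, hv.div hu hu0, ?_⟩
  filter_upwards [hau, hbv, hu.continuousAt.eventually_ne hu0] with x h1 h2 h3
  rw [h1, h2, smul_eq_mul, smul_eq_mul]
  field_simp

/-- The terms of a sum `∑ s ^ i * c i ∘ a` with exponents `i` smaller than the order of `a` have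
distinct orders. -/
theorem analyticOrderAt_sum_pow_mul_comp {s a : ℝ → ℝ} (hs : AnalyticAt ℝ s 0)
    (hs1 : analyticOrderAt s 0 = 1) (ha : AnalyticAt ℝ a 0) (ha0 : a 0 = 0) {d : ℕ}
    (had : analyticOrderAt a 0 = d) {c : ℕ → ℝ → ℝ} (hc : ∀ i, AnalyticAt ℝ (c i) 0)
    (T : Finset ℕ) (hT : ∀ i ∈ T, i < d) :
    analyticOrderAt (fun x => ∑ i ∈ T, s x ^ i * c i (a x)) 0 = ⊤ ∨ ∃ i ∈ T, ∃ q : ℕ,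
      analyticOrderAt (fun x => ∑ i ∈ T, s x ^ i * c i (a x)) 0 = (q * d + i : ℕ) := by
  have hterm : ∀ i, analyticOrderAt (fun x => s x ^ i * c i (a x)) 0 = ⊤ ∨ ∃ q : ℕ,
      analyticOrderAt (fun x => s x ^ i * c i (a x)) 0 = (q * d + i : ℕ) := by
    intro i
    have hci : AnalyticAt ℝ (c i) (a 0) := by rw [ha0]; exact hc i
    have h1 : analyticOrderAt (fun x => s x ^ i * c i (a x)) 0 =
        i + analyticOrderAt (c i) 0 * d := by
      have h2 := analyticOrderAt_mul (hs.pow i) (hci.comp ha)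
      rw [analyticOrderAt_pow hs, hs1, hci.analyticOrderAt_comp ha] at h2
      simp only [ha0, sub_zero, nsmul_eq_mul, mul_one] at h2
      rw [← had]
      exact h2
    rw [h1]
    cases hq : analyticOrderAt (c i) 0 with
    | top =>
      rcases eq_or_ne d 0 with rfl | hd
      · right
        exact ⟨0, by simp⟩
      · left
        rw [ENat.top_mul (by exact_mod_cast hd), add_top]
    | coe q =>
      right
      exact ⟨q, by push_cast; ring⟩
  classical
  induction T using Finset.induction_on with
  | empty =>
    left
    simp [analyticOrderAt_eq_top]
  | insert j T hj ih =>
    have ih' := ih fun i hi => hT i (Finset.mem_insert_of_mem hi)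
    have hfun : (fun x => ∑ i ∈ insert j T, s x ^ i * c i (a x)) =
        (fun x => s x ^ j * c j (a x)) + fun x => ∑ i ∈ T, s x ^ i * c i (a x) := by
      ext x
      simp [Finset.sum_insert hj]
    rw [hfun]
    by_cases heq : analyticOrderAt (fun x => s x ^ j * c j (a x)) 0 =
        analyticOrderAt (fun x => ∑ i ∈ T, s x ^ i * c i (a x)) 0
    · rcases hterm j with h1 | ⟨q, h1⟩
      · left
        rw [← top_le_iff]
        refine le_trans ?_ le_analyticOrderAt_add
        rw [← heq, h1, min_self]
      · exfalso
        rcases ih' with h2 | ⟨i, hi, q', h2⟩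
        · rw [h1, h2] at heq
          exact ENat.natCast_ne_top _ heq
        · rw [h1, h2, Nat.cast_inj] at heq
          have h3 := congrArg (· % d) heq
          simp only [Nat.mul_add_mod_self_right,
            Nat.mod_eq_of_lt (hT i (Finset.mem_insert_of_mem hi)),
            Nat.mod_eq_of_lt (hT j (Finset.mem_insert_self j T))] at h3
          exact hj (h3 ▸ hi)
    · rw [analyticOrderAt_add_of_ne heq]
      rcases min_choice (analyticOrderAt (fun x => s x ^ j * c j (a x)) 0)
        (analyticOrderAt (fun x => ∑ i ∈ T, s x ^ i * c i (a x)) 0) with h | h <;> rw [h]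
      · exact (hterm j).imp_right fun ⟨q, hq⟩ => ⟨j, Finset.mem_insert_self j T, q, hq⟩
      · exact ih'.imp_right fun ⟨i, hi, q, hq⟩ => ⟨i, Finset.mem_insert_of_mem hi, q, hq⟩

namespace JacobianNull

variable {f g h : ℝ × ℝ → ℝ}

/-- Divisibility among germs functionally dependent on `f` can be tested on the first axis. -/
theorem exists_eq_mul (hf : AnalyticAt ℝ f 0) (hf0 : f 0 = 0)
    (hfax : ¬ ∀ᶠ x in 𝓝 (0 : ℝ), f (x, 0) = 0) (hg : JacobianNull f g) (hh : JacobianNull f h)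
    (hgax : ¬ ∀ᶠ x in 𝓝 (0 : ℝ), g (x, 0) = 0) {q : ℝ → ℝ} (hq : AnalyticAt ℝ q 0)
    (hgh : ∀ᶠ x in 𝓝 (0 : ℝ), h (x, 0) = g (x, 0) * q x) :
    ∃ k, JacobianNull f k ∧ ∀ᶠ p in 𝓝 0, h p = g p * k p := by
  have hord : analyticOrderAt (fun x => f (x, 0)) 0 ≠ ⊤ := by rwa [Ne, analyticOrderAt_eq_top]
  obtain ⟨d, hd⟩ := ENat.ne_top_iff_exists.1 hord
  have hd0 : d ≠ 0 := by
    rintro rfl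
    exact (hf.axis.analyticOrderAt_eq_zero).1 hd.symm hf0
  obtain ⟨e, he, hrel⟩ := hf.axis.exists_monic_relation hd0 hd.symm hq
  have he' : ∀ i, JacobianNull f (fun p => e i (f p)) := fun i =>
    (refl hf).comp (by rw [hf0]; exact he i)
  have hnull : JacobianNull f (fun p => h p ^ d +
      ∑ i ∈ Finset.range d, e i (f p) * g p ^ (d - i) * h p ^ i) :=
    (hh.pow d).add (sum _ fun i _ => ((he' i).mul (hg.pow _)).mul (hh.pow i))
  have hzero := eventually_eq_zero hf (by rwa [show f (0, 0) = 0 from hf0]) hnull (by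
    filter_upwards [hrel, hgh] with x h1 h2
    have h3 : g (x, 0) ^ d * (q x ^ d + ∑ i ∈ Finset.range d, e i (f (x, 0)) * q x ^ i) = 0 := by
      rw [h1, mul_zero]
    refine Eq.trans ?_ h3
    rw [h2, mul_add, Finset.mul_sum, mul_pow]
    congr 1
    refine Finset.sum_congr rfl fun i hi => ?_
    have h4 : g (x, 0) ^ d = g (x, 0) ^ (d - i) * g (x, 0) ^ i := by
      rw [← pow_add, Nat.sub_add_cancel (Finset.mem_range.1 hi).le]
    rw [h4]
    ring)
  obtain ⟨k, hk, hgk⟩ := hg.analyticAt.exists_eq_mul_of_monic_relation hh.analyticAt hgax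
    (fun i => (he' i).analyticAt) hzero
  exact ⟨k, of_mul hf hg hk (hh.congr hgk) fun h0 => hgax (eventually_axis h0), hgk⟩

/-- The germs functionally dependent on `f` are exactly the analytic functions of a single
germ. -/
theorem exists_generator (hf : AnalyticAt ℝ f 0) (hf0 : f 0 = 0)
    (hfax : ¬ ∀ᶠ x in 𝓝 (0 : ℝ), f (x, 0) = 0) :
    ∃ σ : ℝ × ℝ → ℝ, AnalyticAt ℝ σ 0 ∧ σ 0 = 0 ∧ ∀ h, JacobianNull f h →
      ∃ β : ℝ → ℝ, AnalyticAt ℝ β 0 ∧ ∀ᶠ p in 𝓝 0, h p = β (σ p) := by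
  classical
  have hord : analyticOrderAt (fun x => f (x, 0)) 0 ≠ ⊤ := by rwa [Ne, analyticOrderAt_eq_top]
  have hex : ∃ d : ℕ, d ≠ 0 ∧ ∃ σ, JacobianNull f σ ∧
      analyticOrderAt (fun x => σ (x, 0)) 0 = d := by
    obtain ⟨d, hd⟩ := ENat.ne_top_iff_exists.1 hord
    refine ⟨d, ?_, f, refl hf, hd.symm⟩
    rintro rfl
    exact (hf.axis.analyticOrderAt_eq_zero).1 hd.symm hf0
  obtain ⟨hd0, σ, hσ, hσd⟩ := Nat.find_spec hex
  have hmin := fun m => Nat.find_min (H := hex) (m := m)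
  set d := Nat.find hex
  have hσ0 : σ (0, 0) = 0 := apply_eq_zero_of_analyticOrderAt_ne_zero
    (f := fun x : ℝ => σ (x, 0)) (z₀ := 0) (by rw [hσd]; exact_mod_cast hd0)
  obtain ⟨s, hs, hs1, hdec⟩ := hσ.analyticAt.axis.exists_coordinate_decomposition hd0 hσd
  refine ⟨σ, hσ.analyticAt, hσ0, fun h hh => ?_⟩
  obtain ⟨c, hc, hsum⟩ := hdec _ hh.analyticAt.axis
  refine ⟨c 0, hc 0, ?_⟩
  have hc0 : AnalyticAt ℝ (c 0) (σ 0) := by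
    rw [show σ 0 = 0 from hσ0]
    exact hc 0
  have hk : JacobianNull f (fun p => h p - c 0 (σ p)) := hh.sub (hσ.comp hc0)
  have hax : (fun x => h (x, 0) - c 0 (σ (x, 0))) =ᶠ[𝓝 0]
      fun x => ∑ i ∈ (Finset.range d).erase 0, s x ^ i * c i (σ (x, 0)) := by
    filter_upwards [hsum] with x hx
    rw [hx, ← Finset.add_sum_erase _ _ (Finset.mem_range.2 (Nat.pos_of_ne_zero hd0))]
    simp
  suffices hz : ∀ᶠ p in 𝓝 0, h p - c 0 (σ p) = 0 from hz.mono fun p hp => sub_eq_zero.1 hp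
  rcases analyticOrderAt_sum_pow_mul_comp hs hs1 hσ.analyticAt.axis hσ0 hσd hc
    ((Finset.range d).erase 0)
    (fun i hi => Finset.mem_range.1 (Finset.mem_of_mem_erase hi)) with htop | ⟨i, hi, q, hq⟩
  · refine eventually_eq_zero hf (by rwa [show f (0, 0) = 0 from hf0]) hk ?_
    rw [← analyticOrderAt_congr hax, analyticOrderAt_eq_top] at htop
    exact htop
  · exfalso
    rw [← analyticOrderAt_congr hax] at hq
    have hpow : analyticOrderAt (fun x => σ (x, 0) ^ q) 0 = (q * d : ℕ) := by
      have h1 := analyticOrderAt_pow hσ.analyticAt.axis q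
      rw [hσd] at h1
      rw [show (fun x => σ (x, 0) ^ q) = (fun x => σ (x, 0)) ^ q from rfl, h1]
      simp
    have hpt : analyticOrderAt (fun x => σ (x, 0) ^ q) 0 ≠ ⊤ := by
      rw [hpow]
      exact ENat.natCast_ne_top _
    obtain ⟨w, hw, hwq⟩ := (hσ.pow q).analyticAt.axis.exists_eq_mul_of_analyticOrderAt_le
      hk.analyticAt.axis hpt (by rw [hpow, hq]; exact_mod_cast Nat.le_add_right _ _)
    obtain ⟨k, hkn, hkeq⟩ := exists_eq_mul hf hf0 hfax (hσ.pow q) hk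
      (fun h0 => hpt (analyticOrderAt_eq_top.2 h0)) hw hwq
    refine hmin i (Finset.mem_range.1 (Finset.mem_of_mem_erase hi))
      ⟨Finset.ne_of_mem_erase hi, k, hkn, ?_⟩
    have h1 : (fun x => h (x, 0) - c 0 (σ (x, 0))) =ᶠ[𝓝 0]
        (fun x => σ (x, 0) ^ q) * fun x => k (x, 0) := eventually_axis hkeq
    rw [analyticOrderAt_congr h1, analyticOrderAt_mul (hσ.pow q).analyticAt.axis
      hkn.analyticAt.axis, hpow, Nat.cast_add] at hq
    exact ENat.add_right_injective_of_ne_top (ENat.natCast_ne_top _) hq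

end JacobianNull

theorem AnalyticAt.exists_not_eventually_const_smul {f : ℝ × ℝ → ℝ} (hf : AnalyticAt ℝ f 0)
    (hfc : ¬ ∀ᶠ p in 𝓝 0, f p = f 0) : ∃ v : ℝ × ℝ, ¬ ∀ᶠ t in 𝓝 (0 : ℝ), f (t • v) = f 0 := by
  by_contra! hcon
  obtain ⟨ε, hε, hball⟩ := Metric.eventually_nhds_iff_ball.1 hf.eventually_analyticAt
  refine hfc ?_
  filter_upwards [ball_mem_nhds (0 : ℝ × ℝ) hε] with p hp
  have hline : IsLinearMap ℝ fun t : ℝ => t • p :=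
    ⟨fun s t => add_smul s t p, fun s t => by rw [smul_eq_mul, mul_smul]⟩
  have hconv : Convex ℝ ((fun t : ℝ => t • p) ⁻¹' ball 0 ε) :=
    (convex_ball (0 : ℝ × ℝ) ε).is_linear_preimage hline
  have han : AnalyticOnNhd ℝ (fun t : ℝ => f (t • p) - f 0)
      ((fun t : ℝ => t • p) ⁻¹' ball 0 ε) := fun t ht =>
    ((hball _ ht).fun_comp (f := fun t : ℝ => t • p)
      (analyticAt_id.smul analyticAt_const)).sub analyticAt_const
  have h := han.eqOn_zero_of_preconnected_of_eventuallyEq_zero hconv.isPreconnected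
    (z₀ := 0) (by simpa using hε) ((hcon p).mono fun t ht => sub_eq_zero.2 ht)
    (show (1 : ℝ) ∈ _ by simpa using hp)
  simpa [sub_eq_zero] using h

theorem JacobianNull.sub_const_left {f g : ℝ × ℝ → ℝ} (h : JacobianNull f g) (c : ℝ) :
    JacobianNull (fun p => f p - c) g := by
  refine ⟨h.analyticAt, ?_⟩
  simpa only [fderiv_sub_const] using h.eventually_eq

theorem ContinuousLinearMap.apply_prod_eq (A : ℝ × ℝ →L[ℝ] ℝ) (a b : ℝ) :
    A (a, b) = a * A (1, 0) + b * A (0, 1) := by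
  rw [← smul_eq_mul, ← smul_eq_mul, ← map_smul, ← map_smul, ← map_add]
  simp

theorem JacobianNull.comp_continuousLinearMap {f g : ℝ × ℝ → ℝ} (hf : AnalyticAt ℝ f 0)
    (h : JacobianNull f g) (A : ℝ × ℝ →L[ℝ] ℝ × ℝ) :
    JacobianNull (fun p => f (A p)) (fun p => g (A p)) := by
  have hA : Filter.Tendsto A (𝓝 0) (𝓝 0) := by
    simpa using A.continuous.tendsto 0
  refine ⟨AnalyticAt.fun_comp (by simpa using h.analyticAt) (A.analyticAt 0), ?_⟩
  filter_upwards [hA.eventually h.eventually_eq, hA.eventually hf.eventually_differentiableAt,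
    hA.eventually h.analyticAt.eventually_differentiableAt] with p h1 h2 h3
  have h4 : ∀ k : ℝ × ℝ → ℝ, DifferentiableAt ℝ k (A p) → ∀ v,
      fderiv ℝ (fun p => k (A p)) p v =
        (A v).1 * fderiv ℝ k (A p) (1, 0) + (A v).2 * fderiv ℝ k (A p) (0, 1) := by
    intro k hk v
    have h5 := (hk.hasFDerivAt.comp p A.hasFDerivAt).fderiv
    simp only [Function.comp_def] at h5
    rw [h5, ContinuousLinearMap.comp_apply, ← ContinuousLinearMap.apply_prod_eq]
  rw [h4 f h2, h4 f h2, h4 g h3, h4 g h3]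
  linear_combination ((A (1, 0)).1 * (A (0, 1)).2 - (A (1, 0)).2 * (A (0, 1)).1) * h1

/-- Two functionally dependent germs are analytic functions of a common germ. -/
theorem JacobianNull.exists_common_generator {f g : ℝ × ℝ → ℝ} (hf : AnalyticAt ℝ f 0)
    (hfc : ¬ ∀ᶠ p in 𝓝 0, f p = f 0) (h : JacobianNull f g) :
    ∃ (σ : ℝ × ℝ → ℝ) (α β : ℝ → ℝ), AnalyticAt ℝ σ 0 ∧ σ 0 = 0 ∧ AnalyticAt ℝ α 0 ∧
      AnalyticAt ℝ β 0 ∧ (∀ᶠ p in 𝓝 0, f p = α (σ p)) ∧ ∀ᶠ p in 𝓝 0, g p = β (σ p) := by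
  obtain ⟨⟨a, b⟩, hv⟩ := hf.exists_not_eventually_const_smul hfc
  have hD : a ^ 2 + b ^ 2 ≠ 0 := by
    intro h0
    have ha : a = 0 := by nlinarith [sq_nonneg a, sq_nonneg b]
    have hb : b = 0 := by nlinarith [sq_nonneg a, sq_nonneg b]
    subst ha hb
    refine hv (Filter.Eventually.of_forall fun t => ?_)
    rw [Prod.mk_zero_zero, smul_zero]
  let A : ℝ × ℝ →L[ℝ] ℝ × ℝ :=
    (a • ContinuousLinearMap.fst ℝ ℝ ℝ - b • ContinuousLinearMap.snd ℝ ℝ ℝ).prod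
      (b • ContinuousLinearMap.fst ℝ ℝ ℝ + a • ContinuousLinearMap.snd ℝ ℝ ℝ)
  let B : ℝ × ℝ →L[ℝ] ℝ × ℝ := (a ^ 2 + b ^ 2)⁻¹ •
    (a • ContinuousLinearMap.fst ℝ ℝ ℝ + b • ContinuousLinearMap.snd ℝ ℝ ℝ).prod
      (a • ContinuousLinearMap.snd ℝ ℝ ℝ - b • ContinuousLinearMap.fst ℝ ℝ ℝ)
  have hAB : ∀ p, A (B p) = p := by
    rintro ⟨x, y⟩
    ext
    · simp [A, B]
      field_simp
      ring
    · simp [A, B]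
      field_simp
      ring
  have hB : Filter.Tendsto B (𝓝 0) (𝓝 0) := by
    simpa using B.continuous.tendsto 0
  have hfA : AnalyticAt ℝ (fun p => f (A p)) 0 :=
    AnalyticAt.fun_comp (by simpa using hf) (A.analyticAt 0)
  obtain ⟨σ, hσ, hσ0, hgen⟩ := JacobianNull.exists_generator (f := fun p => f (A p) - f 0)
    (hfA.sub analyticAt_const) (by simp) (by
      refine fun h0 => hv (h0.mono fun t ht => ?_)
      rw [← sub_eq_zero, ← ht]
      simp [A, mul_comm])
  obtain ⟨α, hα, hfα⟩ := hgen _ ((JacobianNull.refl hfA).sub_const_left (f 0))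
  obtain ⟨β, hβ, hgβ⟩ := hgen _ ((h.comp_continuousLinearMap hf A).sub_const_left (f 0))
  refine ⟨fun p => σ (B p), α, β, AnalyticAt.fun_comp (by simpa using hσ) (B.analyticAt 0),
    by simpa using hσ0, hα, hβ, ?_, ?_⟩
  · filter_upwards [hB.eventually hfα] with p hp
    rwa [hAB] at hp
  · filter_upwards [hB.eventually hgβ] with p hp
    rwa [hAB] at hp

theorem pdx_eq_fderiv {f : ℝ × ℝ → ℝ} {p : ℝ × ℝ} (hf : DifferentiableAt ℝ f p) :
    pdx f p = fderiv ℝ f p (1, 0) :=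
  (hf.hasFDerivAt.comp_hasDerivAt p.1
    ((hasDerivAt_id p.1).prodMk (hasDerivAt_const p.1 p.2))).deriv

theorem pdy_eq_fderiv {f : ℝ × ℝ → ℝ} {p : ℝ × ℝ} (hf : DifferentiableAt ℝ f p) :
    pdy f p = fderiv ℝ f p (0, 1) :=
  (hf.hasFDerivAt.comp_hasDerivAt p.2
    ((hasDerivAt_const p.2 p.1).prodMk (hasDerivAt_id p.2))).deriv

/-- If `f, g` are real analytic on a connected open neighborhood `U` of the origin in `ℝ²`,
neither constant on any neighborhood of the origin, and `J[f,g] ≡ 0` on `U`, then near the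
origin `f = α ∘ σ` and `g = β ∘ σ` for a non-constant real analytic function `σ` with
`σ(0,0) = 0` and non-constant real analytic functions `α, β` of one variable. -/
theorem common_first_integral_of_vanishing_jacobian
    (U : Set (ℝ × ℝ)) (hUopen : IsOpen U) (hUconn : IsConnected U) (hU0 : (0, 0) ∈ U)
    (f g : ℝ × ℝ → ℝ) (hf : AnalyticOnNhd ℝ f U) (hg : AnalyticOnNhd ℝ g U)
    (hfnc : ∀ W ∈ 𝓝 ((0, 0) : ℝ × ℝ), ¬∃ cf : ℝ, EqOn f (fun _ => cf) W)
    (hgnc : ∀ W ∈ 𝓝 ((0, 0) : ℝ × ℝ), ¬∃ cg : ℝ, EqOn g (fun _ => cg) W)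
    (hJ : ∀ p ∈ U, jacDet f g p = 0) :
    ∃ (V : Set (ℝ × ℝ)) (σ : ℝ × ℝ → ℝ) (J : Set ℝ) (α β : ℝ → ℝ),
      IsOpen V ∧ (0, 0) ∈ V ∧ V ⊆ U ∧
      AnalyticOnNhd ℝ σ V ∧ σ (0, 0) = 0 ∧ (¬∃ cσ : ℝ, EqOn σ (fun _ => cσ) V) ∧
      IsOpen J ∧ σ '' V ⊆ J ∧
      AnalyticOnNhd ℝ α J ∧ (¬∃ cα : ℝ, EqOn α (fun _ => cα) J) ∧
      AnalyticOnNhd ℝ β J ∧ (¬∃ cβ : ℝ, EqOn β (fun _ => cβ) J) ∧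
      (∀ p ∈ V, f p = α (σ p)) ∧ (∀ p ∈ V, g p = β (σ p)) := by
  have hU : U ∈ 𝓝 ((0, 0) : ℝ × ℝ) := hUopen.mem_nhds hU0
  have hnull : JacobianNull f g := by
    refine ⟨hg _ hU0, ?_⟩
    filter_upwards [hU] with p hp
    have h := hJ p hp
    rwa [jacDet, pdx_eq_fderiv (hf p hp).differentiableAt, pdy_eq_fderiv (hf p hp).differentiableAt,
      pdx_eq_fderiv (hg p hp).differentiableAt, pdy_eq_fderiv (hg p hp).differentiableAt,
      sub_eq_zero] at h
  obtain ⟨σ, α, β, hσ, hσ0, hα, hβ, hfα, hgβ⟩ := hnull.exists_common_generator (hf _ hU0)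
    fun h => hfnc _ h ⟨f 0, fun p hp => hp⟩
  have hαβ : ∀ᶠ t in 𝓝 (σ 0), AnalyticAt ℝ α t ∧ AnalyticAt ℝ β t := by
    rw [hσ0]
    exact hα.eventually_analyticAt.and hβ.eventually_analyticAt
  have hS : ∀ᶠ p in 𝓝 ((0, 0) : ℝ × ℝ), p ∈ U ∧ AnalyticAt ℝ σ p ∧
      (AnalyticAt ℝ α (σ p) ∧ AnalyticAt ℝ β (σ p)) ∧ f p = α (σ p) ∧ g p = β (σ p) := by
    filter_upwards [hU, hσ.eventually_analyticAt, hσ.continuousAt.eventually hαβ, hfα, hgβ]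
      with p h1 h2 h3 h4 h5 using ⟨h1, h2, h3, h4, h5⟩
  obtain ⟨V, hV, hVopen, hV0⟩ := _root_.eventually_nhds_iff.1 hS
  have hVn : V ∈ 𝓝 ((0, 0) : ℝ × ℝ) := hVopen.mem_nhds hV0
  have hVJ : σ '' V ⊆ {t | AnalyticAt ℝ α t} ∩ {t | AnalyticAt ℝ β t} := by
    rintro _ ⟨p, hp, rfl⟩
    exact (hV p hp).2.2.1
  refine ⟨V, σ, {t | AnalyticAt ℝ α t} ∩ {t | AnalyticAt ℝ β t}, α, β, hVopen, hV0,
    fun p hp => (hV p hp).1, fun p hp => (hV p hp).2.1, hσ0, ?_,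
    (isOpen_analyticAt ℝ α).inter (isOpen_analyticAt ℝ β), hVJ, fun t ht => ht.1, ?_,
    fun t ht => ht.2, ?_, fun p hp => (hV p hp).2.2.2.1, fun p hp => (hV p hp).2.2.2.2⟩
  · rintro ⟨c, hc⟩
    refine hfnc V hVn ⟨α c, fun p hp => ?_⟩
    rw [(hV p hp).2.2.2.1, hc hp]
  · rintro ⟨c, hc⟩
    refine hfnc V hVn ⟨c, fun p hp => ?_⟩
    rw [(hV p hp).2.2.2.1]
    exact hc (hVJ (mem_image_of_mem σ hp))
  · rintro ⟨c, hc⟩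
    refine hgnc V hVn ⟨c, fun p hp => ?_⟩
    rw [(hV p hp).2.2.2.2]
    exact hc (hVJ (mem_image_of_mem σ hp))
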